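/- Cutoff multiplication estimate: For every t ∈ (0,1) and C₀ > 0 there exists a constant C = C(d, t, C₀) with the following property. Let n ∈ ℤ and let φ ∈ C^∞(ℝ^d) satisfy φ ≡ 1 on Q_{n−1}, |∇φ(x)| ≤ C₀ 3^{−n} and |∇²φ(x)| ≤ C₀ 3^{−2n} for all x ∈ Q_n. Then for every continuously differentiable u on a neighbourhood of the closure of Q_n with ⨍_{Q_n} u = 0, ‖u ∇φ‖_{H̲^t(Q_n)} ≤ C 3^{−n} ‖∇u‖_{H̲̊^{−(1−t)}(Q_n)}. -/

import Mathlib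

open MeasureTheory

noncomputable section

/-- The triadic cube `Q_n = (-3^n/2, 3^n/2)^d` in `ℝ^d`. -/
def Qc (d : ℕ) (n : ℤ) : Set (Fin d → ℝ) := {x | ∀ i, |x i| < 3 ^ n / 2}

/-- The cube `z + Q_k` of scale `k` centred at `z`. -/
def cube (d : ℕ) (k : ℤ) (z : Fin d → ℝ) : Set (Fin d → ℝ) := {x | ∀ i, |x i - z i| < 3 ^ k / 2}

/-- The lattice `3^r ℤ^d` viewed inside `ℝ^d`. -/
def latt (d : ℕ) (r : ℤ) : Set (Fin d → ℝ) := {z | ∃ m : Fin d → ℤ, z = fun i => 3 ^ r * (m i : ℝ)}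

/-- The lattice points `z ∈ 3^{k-1}ℤ^d` such that `z + Q_k ⊆ Q_n`. -/
def subLatt (d : ℕ) (k n : ℤ) : Set (Fin d → ℝ) :=
  {z | z ∈ latt d (k - 1) ∧ cube d k z ⊆ Qc d n}

/-- Average of `f` over a (finite) set `S`. -/
def avgSet {α : Type*} (S : Set α) (f : α → ℝ) : ℝ := (S.ncard : ℝ)⁻¹ * ∑ᶠ z ∈ S, f z

/-- Normalized `L²` norm of a vector field over `V` (Euclidean norm inside). -/
def vecL2 (d : ℕ) (V : Set (Fin d → ℝ)) (F : (Fin d → ℝ) → (Fin d → ℝ)) : ℝ :=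
  Real.sqrt (⨍ x in V, ∑ i, (F x i) ^ 2)

/-- The normalized norm `‖F‖_{H̲^t(Q_n)}` of a vector field:
`3^{-tn}‖F‖_{L̲²(Q_n)}` plus the fractional seminorm `[F]_{H̲^t(Q_n)}`. -/
def vecFracNorm (d : ℕ) (t : ℝ) (n : ℤ) (F : (Fin d → ℝ) → (Fin d → ℝ)) : ℝ :=
  (3 : ℝ) ^ (-(t * (n : ℝ))) * vecL2 d (Qc d n) F +
  Real.sqrt (∑' j : ℕ, (3 : ℝ) ^ (-2 * t * ((n : ℝ) - (j : ℝ))) *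
    avgSet (subLatt d (n - j) n) (fun z =>
      ⨍ x in cube d (n - j) z, ∑ i, (F x i - ⨍ y in cube d (n - j) z, F y i) ^ 2))

/-- The quantity `‖F‖_{H̲̊^{-s}(Q_n)}` for a vector field `F`. -/
def ringNeg (d : ℕ) (s : ℝ) (n : ℤ) (F : (Fin d → ℝ) → (Fin d → ℝ)) : ℝ :=
  Real.sqrt (∑' j : ℕ, (3 : ℝ) ^ (2 * s * ((n : ℝ) - (j : ℝ))) *
    avgSet (subLatt d (n - j) n) (fun z => ∑ i, (⨍ x in cube d (n - j) z, F x i) ^ 2))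

/-- The gradient of a scalar function on `ℝ^d`, as a vector field. -/
def grad (d : ℕ) (u : (Fin d → ℝ) → ℝ) (x : Fin d → ℝ) : Fin d → ℝ :=
  fun i => fderiv ℝ u x (Pi.single i 1)

/-! ### Triadic grids -/

namespace TriadicGrid

variable {d : ℕ}

/-- Index of the half-open grid cell of side `3 ^ j` containing `x`. -/
def idx (j : ℤ) (x : Fin d → ℝ) : Fin d → ℤ := fun i => ⌊x i / 3 ^ j + 1 / 2⌋

/-- The half-open grid cell of side `3 ^ j` centred at `3 ^ j * m`. -/
def cell (j : ℤ) (m : Fin d → ℤ) : Set (Fin d → ℝ) := {x | idx j x = m}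

/-- The block of `3 ^ d` grid cells of side `3 ^ j` around the cell with index `c`. -/
def block (j : ℤ) (c : Fin d → ℤ) : Set (Fin d → ℝ) := {x | ∀ i, |idx j x i - c i| ≤ 1}

/-- The average of `f` over the grid cell of side `3 ^ j` containing `x`. -/
def cellAvg (j : ℤ) (f : (Fin d → ℝ) → ℝ) (x : Fin d → ℝ) : ℝ :=
  ⨍ y in cell j (idx j x), f y

/-- `S` is a union of grid cells of side `3 ^ j`. -/
def IsGridSet (j : ℤ) (S : Set (Fin d → ℝ)) : Prop :=
  ∀ ⦃x y⦄, idx j x = idx j y → x ∈ S → y ∈ S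

/-- The half-open box of side `r` centred at `z`. -/
def hbox (z : Fin d → ℝ) (r : ℝ) : Set (Fin d → ℝ) :=
  Set.pi Set.univ fun i => Set.Ico (z i - r / 2) (z i + r / 2)

lemma measurable_idx (j : ℤ) : Measurable (idx (d := d) j) := by
  refine measurable_pi_lambda _ fun i => Int.measurable_floor.comp ?_
  fun_prop

lemma idx_eq_iff (j : ℤ) (x : Fin d → ℝ) (i : Fin d) (a : ℤ) :
    idx j x i = a ↔ 3 ^ j * (a : ℝ) - 3 ^ j / 2 ≤ x i ∧ x i < 3 ^ j * (a : ℝ) + 3 ^ j / 2 := by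
  have h3 : (0 : ℝ) < 3 ^ j := by positivity
  have e : x i = 3 ^ j * (x i / 3 ^ j) := by field_simp
  rw [idx, Int.floor_eq_iff]
  constructor
  · rintro ⟨h1, h2⟩
    constructor <;> rw [e] <;> nlinarith
  · rintro ⟨h1, h2⟩
    rw [e] at h1 h2
    constructor
    · by_contra hlt; push Not at hlt; nlinarith
    · by_contra hlt; push Not at hlt; nlinarith

lemma cell_eq_hbox (j : ℤ) (m : Fin d → ℤ) :
    cell j m = hbox (fun i => 3 ^ j * (m i : ℝ)) (3 ^ j) := by
  ext x
  simp only [cell, hbox, Set.mem_ofPred_eq, Set.mem_pi, Set.mem_univ, true_imp_iff, Set.mem_Ico,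
    funext_iff, idx_eq_iff]

lemma idx_succ (j : ℤ) (x : Fin d → ℝ) (i : Fin d) : idx (j + 1) x i = (idx j x i + 1) / 3 := by
  have h : x i / 3 ^ (j + 1) + 1 / 2 = (x i / 3 ^ j + 1 / 2 + 1) / ((3 : ℕ) : ℝ) := by
    rw [zpow_add₀ (by norm_num)]; push_cast; field_simp; ring
  simp only [idx]
  rw [h, Int.floor_div_natCast, Int.floor_add_one]
  rfl

lemma cell_succ (j : ℤ) (m : Fin d → ℤ) : cell (j + 1) m = block j (fun i => 3 * m i) := by
  ext x
  simp only [cell, block, Set.mem_ofPred_eq, funext_iff, idx_succ, abs_le]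
  refine forall_congr' fun i => ?_
  omega

lemma block_eq_hbox (j : ℤ) (c : Fin d → ℤ) :
    block j c = hbox (fun i => 3 ^ j * (c i : ℝ)) (3 ^ (j + 1)) := by
  have h3 : (0 : ℝ) < 3 ^ j := by positivity
  have h33 : (3 : ℝ) ^ (j + 1) = 3 * 3 ^ j := by rw [zpow_add₀ (by norm_num)]; ring
  ext x
  simp only [block, hbox, Set.mem_ofPred_eq, Set.mem_pi, Set.mem_univ, true_imp_iff, Set.mem_Ico,
    h33]
  refine forall_congr' fun i => ?_
  obtain ⟨h1, h2⟩ := (idx_eq_iff j x i _).1 rfl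
  rw [abs_le]
  constructor
  · rintro ⟨h3, h4⟩
    have h3' : (c i : ℝ) - 1 ≤ idx j x i := by exact_mod_cast (by omega : c i - 1 ≤ idx j x i)
    have h4' : (idx j x i : ℝ) ≤ c i + 1 := by exact_mod_cast (by omega : idx j x i ≤ c i + 1)
    constructor <;> nlinarith
  · rintro ⟨h3, h4⟩
    have h5 : (c i : ℝ) - 2 < idx j x i := by
      by_contra h; push Not at h; nlinarith
    have h6 : (idx j x i : ℝ) < c i + 2 := by
      by_contra h; push Not at h; nlinarith
    have h5' : c i - 2 < idx j x i := by exact_mod_cast h5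
    have h6' : idx j x i < c i + 2 := by exact_mod_cast h6
    omega

lemma cube_ae_eq_hbox (k : ℤ) (z : Fin d → ℝ) : cube d k z =ᵐ[volume] hbox z (3 ^ k) := by
  have h : cube d k z = Set.pi Set.univ fun i => Set.Ioo (z i - 3 ^ k / 2) (z i + 3 ^ k / 2) := by
    ext x
    simp only [cube, Set.mem_ofPred_eq, Set.mem_pi, Set.mem_univ, true_imp_iff, Set.mem_Ioo,
      abs_lt]
    refine forall_congr' fun i => ?_
    constructor <;> rintro ⟨h1, h2⟩ <;> constructor <;> linarith
  rw [h]
  exact Measure.univ_pi_Ioo_ae_eq_Icc.trans Measure.univ_pi_Ico_ae_eq_Icc.symm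

lemma volume_real_hbox (z : Fin d → ℝ) {r : ℝ} (hr : 0 ≤ r) : volume.real (hbox z r) = r ^ d := by
  rw [Measure.real, hbox, Real.volume_pi_Ico_toReal (fun i => by linarith)]
  simp

lemma volume_hbox_lt_top (z : Fin d → ℝ) (r : ℝ) : volume (hbox z r) < ⊤ := by
  rw [hbox, Real.volume_pi_Ico]
  exact ENNReal.prod_lt_top fun i _ => ENNReal.ofReal_lt_top

lemma isBounded_hbox (z : Fin d → ℝ) (r : ℝ) : Bornology.IsBounded (hbox z r) :=
  (Metric.isBounded_Icc (fun i => z i - r / 2) (fun i => z i + r / 2)).subset fun _ hx =>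
    ⟨fun i => (hx i trivial).1, fun i => (hx i trivial).2.le⟩

lemma volume_real_cell (j : ℤ) (m : Fin d → ℤ) : volume.real (cell j m) = (3 ^ j) ^ d := by
  rw [cell_eq_hbox, volume_real_hbox _ (by positivity)]

lemma volume_cell_lt_top (j : ℤ) (m : Fin d → ℤ) : volume (cell j m) < ⊤ := by
  rw [cell_eq_hbox]; exact volume_hbox_lt_top _ _

lemma volume_cell_ne_zero (j : ℤ) (m : Fin d → ℤ) : volume (cell j m) ≠ 0 := by
  intro h
  have h1 := volume_real_cell j m
  rw [Measure.real, h] at h1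
  have : (0 : ℝ) < (3 ^ j) ^ d := by positivity
  simp at h1
  linarith

lemma volume_real_block (j : ℤ) (m : Fin d → ℤ) :
    volume.real (block j m) = (3 ^ (j + 1)) ^ d := by
  rw [block_eq_hbox, volume_real_hbox _ (by positivity)]

lemma volume_block_lt_top (j : ℤ) (m : Fin d → ℤ) : volume (block j m) < ⊤ := by
  rw [block_eq_hbox]; exact volume_hbox_lt_top _ _

lemma isGridSet_cell (j : ℤ) (m : Fin d → ℤ) : IsGridSet j (cell j m) :=
  fun _ _ h hx => h.symm.trans hx

lemma isGridSet_block (j : ℤ) (m : Fin d → ℤ) : IsGridSet j (block j m) :=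
  fun _ _ h hx i => h ▸ hx i

lemma idx_eq_of_le {j k : ℤ} (h : j ≤ k) {x y : Fin d → ℝ} (hxy : idx j x = idx j y) :
    idx k x = idx k y := by
  induction k, h using Int.leInduction with
  | base => exact hxy
  | succ k _ ih => funext i; rw [idx_succ, idx_succ, ih]

lemma IsGridSet.of_le {j k : ℤ} {S : Set (Fin d → ℝ)} (hS : IsGridSet k S) (h : j ≤ k) :
    IsGridSet j S := fun _ _ hxy hx => hS (idx_eq_of_le h hxy) hx

lemma IsGridSet.measurableSet {j : ℤ} {S : Set (Fin d → ℝ)} (hS : IsGridSet j S) :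
    MeasurableSet S := by
  have : S = idx j ⁻¹' (idx j '' S) := by
    ext x
    exact ⟨fun hx => ⟨x, hx, rfl⟩, fun ⟨y, hy, h⟩ => hS h hy⟩
  rw [this]
  exact measurable_idx j (MeasurableSet.of_discrete)

lemma IsGridSet.cell_subset {j : ℤ} {S : Set (Fin d → ℝ)} (hS : IsGridSet j S) {x : Fin d → ℝ}
    (hx : x ∈ S) : cell j (idx j x) ⊆ S := fun _ hy => hS (Eq.symm hy) hx

lemma measurableSet_cell (j : ℤ) (m : Fin d → ℤ) : MeasurableSet (cell j m) :=
  (isGridSet_cell j m).measurableSet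

lemma measurableSet_block (j : ℤ) (m : Fin d → ℤ) : MeasurableSet (block j m) :=
  (isGridSet_block j m).measurableSet

lemma isBounded_block (j : ℤ) (m : Fin d → ℤ) : Bornology.IsBounded (block j m) := by
  rw [block_eq_hbox]; exact isBounded_hbox _ _

lemma isBounded_cell (j : ℤ) (m : Fin d → ℤ) : Bornology.IsBounded (cell j m) := by
  rw [cell_eq_hbox]; exact isBounded_hbox _ _

lemma finite_image_idx (j : ℤ) {S : Set (Fin d → ℝ)} (hb : Bornology.IsBounded S) :
    (idx j '' S).Finite := by
  obtain ⟨R, hR⟩ := hb.exists_norm_le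
  refine (Set.finite_Icc (fun _ => ⌊(-R) / 3 ^ j + 1 / 2⌋) (fun _ => ⌊R / 3 ^ j + 1 / 2⌋)).subset ?_
  rintro _ ⟨x, hx, rfl⟩
  have h : ∀ i, |x i| ≤ R := fun i => (norm_le_pi_norm x i).trans (hR x hx)
  constructor <;> intro i <;> simp only [idx] <;> gcongr
  · exact neg_le_of_abs_le (h i)
  · exact le_of_abs_le (h i)

lemma IsGridSet.eq_biUnion {j : ℤ} {S : Set (Fin d → ℝ)} (hS : IsGridSet j S) :
    S = ⋃ m ∈ idx j '' S, cell j m := by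
  ext x
  simp only [Set.mem_iUnion]
  refine ⟨fun hx => ⟨idx j x, ⟨x, hx, rfl⟩, rfl⟩, ?_⟩
  rintro ⟨_, ⟨y, hy, rfl⟩, hx⟩
  exact hS (Eq.symm hx) hy

lemma disjoint_cell (j : ℤ) {m m' : Fin d → ℤ} (h : m ≠ m') : Disjoint (cell j m) (cell j m') :=
  Set.disjoint_left.2 fun _ hx hx' => h (hx.symm.trans hx')

/-- An integral over a bounded grid set splits into the integrals over its cells. -/
lemma setIntegral_eq_sum {j : ℤ} {S : Set (Fin d → ℝ)} {F : Finset (Fin d → ℤ)}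
    (hF : S = ⋃ m ∈ F, cell j m) {f : (Fin d → ℝ) → ℝ}
    (hf : IntegrableOn f S) : ∫ x in S, f x = ∑ m ∈ F, ∫ x in cell j m, f x := by
  subst hF
  refine integral_biUnion_finset F (fun m _ => measurableSet_cell j m)
    (fun m _ m' _ h => disjoint_cell j h) fun m hm => hf.mono_set ?_
  exact Set.subset_biUnion_of_mem (u := fun m => cell j m) (Finset.mem_coe.2 hm)

/-- Integral inequalities over bounded grid sets can be checked cell by cell. -/
lemma setIntegral_le_of_cell {j : ℤ} {S : Set (Fin d → ℝ)} (hS : IsGridSet j S)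
    (hb : Bornology.IsBounded S) {f g : (Fin d → ℝ) → ℝ} (hf : IntegrableOn f S)
    (hg : IntegrableOn g S)
    (h : ∀ m, cell j m ⊆ S → ∫ x in cell j m, f x ≤ ∫ x in cell j m, g x) :
    ∫ x in S, f x ≤ ∫ x in S, g x := by
  have hF : S = ⋃ m ∈ (finite_image_idx j hb).toFinset, cell j m := by
    simpa using hS.eq_biUnion
  rw [setIntegral_eq_sum hF hf, setIntegral_eq_sum hF hg]
  refine Finset.sum_le_sum fun m hm => h m ?_
  obtain ⟨x, hx, rfl⟩ := (finite_image_idx j hb).mem_toFinset.1 hm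
  exact hS.cell_subset hx

lemma setIntegral_congr_of_cell {j : ℤ} {S : Set (Fin d → ℝ)} (hS : IsGridSet j S)
    (hb : Bornology.IsBounded S) {f g : (Fin d → ℝ) → ℝ} (hf : IntegrableOn f S)
    (hg : IntegrableOn g S)
    (h : ∀ m, cell j m ⊆ S → ∫ x in cell j m, f x = ∫ x in cell j m, g x) :
    ∫ x in S, f x = ∫ x in S, g x :=
  (setIntegral_le_of_cell hS hb hf hg fun m hm => (h m hm).le).antisymm
    (setIntegral_le_of_cell hS hb hg hf fun m hm => (h m hm).ge)

/-! ### Cell averages -/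

lemma integrableOn_of_bdd {f : (Fin d → ℝ) → ℝ} (hf : Measurable f) {L : ℝ}
    (hL : ∀ x, |f x| ≤ L) {S : Set (Fin d → ℝ)} (hb : Bornology.IsBounded S) :
    IntegrableOn f S :=
  Measure.integrableOn_of_bounded hb.measure_lt_top.ne hf.aestronglyMeasurable
    (Filter.Eventually.of_forall hL)

lemma measurable_cellAvg (j : ℤ) (f : (Fin d → ℝ) → ℝ) : Measurable (cellAvg j f) :=
  (measurable_of_countable fun m : Fin d → ℤ => ⨍ y in cell j m, f y).comp (measurable_idx j)

lemma cellAvg_eq {j : ℤ} {f : (Fin d → ℝ) → ℝ} {m : Fin d → ℤ} {x : Fin d → ℝ}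
    (hx : x ∈ cell j m) : cellAvg j f x = ⨍ y in cell j m, f y := by
  rw [cellAvg, show idx j x = m from hx]

lemma abs_setAverage_le {f : (Fin d → ℝ) → ℝ} {L : ℝ} {S : Set (Fin d → ℝ)} (h0 : volume S ≠ 0)
    (ht : volume S ≠ ⊤) (hL : ∀ x ∈ S, |f x| ≤ L) : |⨍ y in S, f y| ≤ L := by
  have h1 := norm_setIntegral_le_of_norm_le_const (μ := volume) (f := f) (C := L) ht.lt_top hL
  have h2 : 0 < volume.real S := ENNReal.toReal_pos h0 ht
  rw [setAverage_eq, smul_eq_mul, abs_mul, abs_inv, abs_of_pos h2, inv_mul_le_iff₀ h2]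
  rw [Real.norm_eq_abs] at h1
  linarith

lemma abs_cellAvg_le {f : (Fin d → ℝ) → ℝ} {L : ℝ} (hL : ∀ x, |f x| ≤ L) (j : ℤ)
    (x : Fin d → ℝ) : |cellAvg j f x| ≤ L :=
  abs_setAverage_le (volume_cell_ne_zero _ _) (volume_cell_lt_top _ _).ne fun y _ => hL y

lemma setIntegral_cell_cellAvg (j : ℤ) (m : Fin d → ℤ) (f : (Fin d → ℝ) → ℝ) :
    ∫ x in cell j m, cellAvg j f x = ∫ x in cell j m, f x := by
  rw [setIntegral_congr_fun (measurableSet_cell j m) (fun x hx => cellAvg_eq hx),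
    setIntegral_const, measure_smul_setAverage _ (volume_cell_lt_top _ _).ne]

lemma setIntegral_cellAvg {j : ℤ} {S : Set (Fin d → ℝ)} (hS : IsGridSet j S)
    (hb : Bornology.IsBounded S) {f : (Fin d → ℝ) → ℝ} (hf : Measurable f) {L : ℝ}
    (hL : ∀ x, |f x| ≤ L) : ∫ x in S, cellAvg j f x = ∫ x in S, f x :=
  setIntegral_congr_of_cell hS hb
    (integrableOn_of_bdd (measurable_cellAvg j f) (abs_cellAvg_le hL j) hb)
    (integrableOn_of_bdd hf hL hb) fun m _ => setIntegral_cell_cellAvg j m f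

/-- A function with zero mean on cells only sees the oscillation on cells of a test function. -/
lemma abs_setIntegral_mul_le_of_osc {j : ℤ} {S : Set (Fin d → ℝ)} (hS : IsGridSet j S)
    (hb : Bornology.IsBounded S) {f g : (Fin d → ℝ) → ℝ} (hf : Measurable f) {L : ℝ}
    (hL : ∀ x, |f x| ≤ L) (hg : Measurable g) {M : ℝ} (hM : ∀ x, |g x| ≤ M) {ω : ℝ}
    (h0 : ∀ m, cell j m ⊆ S → ∫ x in cell j m, f x = 0)
    (hω : ∀ x ∈ S, ∀ y ∈ S, idx j x = idx j y → |g x - g y| ≤ ω) :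
    |∫ x in S, f x * g x| ≤ ω * ∫ x in S, |f x| := by
  have hfg : ∀ x, |f x * g x| ≤ L * M := fun x => by
    rw [abs_mul]
    exact mul_le_mul (hL x) (hM x) (abs_nonneg _) ((abs_nonneg _).trans (hL x))
  have i1 : ∀ {T : Set (Fin d → ℝ)}, Bornology.IsBounded T →
      IntegrableOn (fun x => f x * g x) T := fun hT => integrableOn_of_bdd (hf.mul hg) hfg hT
  have i2 : ∀ {T : Set (Fin d → ℝ)}, Bornology.IsBounded T → IntegrableOn (fun x => ω * |f x|) T :=
    fun hT => (integrableOn_of_bdd hf hL hT).abs.const_mul ω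
  have key : ∀ m, cell j m ⊆ S → |∫ x in cell j m, f x * g x| ≤ ∫ x in cell j m, ω * |f x| := by
    intro m hm
    have hbm := isBounded_cell j m
    obtain ⟨y, hy⟩ : (cell j m).Nonempty :=
      nonempty_of_measure_ne_zero (volume_cell_ne_zero j m)
    have e : ∫ x in cell j m, f x * g x = ∫ x in cell j m, f x * (g x - g y) := by
      simp only [mul_sub]
      rw [integral_sub (i1 hbm) ((integrableOn_of_bdd hf hL hbm).mul_const _),
        integral_mul_const, h0 m hm, zero_mul, sub_zero]
    rw [e]
    refine (abs_integral_le_integral_abs).trans ?_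
    refine setIntegral_mono_on ?_ (i2 hbm) (measurableSet_cell j m) fun x hx => ?_
    · simp only [mul_sub]
      exact ((i1 hbm).sub ((integrableOn_of_bdd hf hL hbm).mul_const _)).abs
    · rw [abs_mul, mul_comm]
      exact mul_le_mul_of_nonneg_right
        (hω x (hm hx) y (hm hy) (Eq.trans hx (Eq.symm hy))) (abs_nonneg _)
  rw [← integral_const_mul]
  refine abs_le.2 ⟨?_, ?_⟩
  · rw [neg_le, ← integral_neg]
    refine setIntegral_le_of_cell hS hb (i1 hb).neg (i2 hb) fun m hm => ?_
    rw [integral_neg]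
    exact (neg_le_abs _).trans (key m hm)
  · exact setIntegral_le_of_cell hS hb (i1 hb) (i2 hb) fun m hm => (le_abs_self _).trans (key m hm)

lemma dist_le_of_idx_eq {j : ℤ} {x y : Fin d → ℝ} (h : idx j x = idx j y) :
    dist x y ≤ 3 ^ j := by
  refine (dist_pi_le_iff (by positivity)).2 fun i => ?_
  obtain ⟨h1, h2⟩ := (idx_eq_iff j x i _).1 rfl
  obtain ⟨h3, h4⟩ := (idx_eq_iff j y i _).1 (congrFun h i).symm
  rw [Real.dist_eq, abs_le]
  constructor <;> linarith

lemma setAverage_sub_const {f : (Fin d → ℝ) → ℝ} {S : Set (Fin d → ℝ)} (h0 : volume S ≠ 0)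
    (ht : volume S ≠ ⊤) (hf : IntegrableOn f S) (c : ℝ) :
    ⨍ y in S, (f y - c) = (⨍ y in S, f y) - c := by
  have h2 : 0 < volume.real S := ENNReal.toReal_pos h0 ht
  rw [setAverage_eq, setAverage_eq, integral_sub hf (integrableOn_const ht), setIntegral_const]
  simp only [smul_eq_mul]
  field_simp

lemma tendsto_cellAvg {k : ℤ} {S : Set (Fin d → ℝ)} (hS : IsGridSet k S) {f : (Fin d → ℝ) → ℝ}
    (hf : Measurable f) {L : ℝ} (hL : ∀ x, |f x| ≤ L) (hc : ContinuousOn f S) {x : Fin d → ℝ}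
    (hx : x ∈ S) : Filter.Tendsto (fun N : ℕ => cellAvg (k - N) f x) Filter.atTop (nhds (f x)) := by
  rw [Metric.tendsto_atTop]
  intro ε hε
  obtain ⟨δ, hδ, h⟩ := Metric.continuousWithinAt_iff.1 (hc x hx) (ε / 2) (by positivity)
  obtain ⟨M, hM⟩ := exists_pow_lt_of_lt_one (show 0 < δ / 3 ^ k by positivity)
    (show (1 / 3 : ℝ) < 1 by norm_num)
  refine ⟨M, fun N hN => ?_⟩
  have h3 : (3 : ℝ) ^ (k - (N : ℤ)) < δ := by
    have e : (3 : ℝ) ^ (k - (N : ℤ)) = 3 ^ k * (1 / 3) ^ N := by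
      rw [zpow_sub₀ (by norm_num), zpow_natCast, one_div, inv_pow]; rfl
    have h4 : (1 / 3 : ℝ) ^ N ≤ (1 / 3) ^ M := pow_le_pow_of_le_one (by norm_num) (by norm_num) hN
    rw [e, mul_comm]
    exact (lt_div_iff₀ (by positivity)).1 (h4.trans_lt hM)
  set j := k - (N : ℤ)
  have hlt := (volume_cell_lt_top j (idx j x)).ne
  have h0 := volume_cell_ne_zero j (idx j x)
  rw [Real.dist_eq, cellAvg, ← setAverage_sub_const h0 hlt
    (integrableOn_of_bdd hf hL (isBounded_cell _ _))]
  refine (abs_setAverage_le (L := ε / 2) h0 hlt fun y hy => ?_).trans_lt (by linarith)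
  have hy' : y ∈ S := (hS.of_le (by simp [j])).cell_subset hx hy
  exact (h hy' ((dist_le_of_idx_eq hy).trans_lt h3)).le

lemma tendsto_setIntegral_of_bdd {S : Set (Fin d → ℝ)} (hS : MeasurableSet S)
    (hb : Bornology.IsBounded S) {F : ℕ → (Fin d → ℝ) → ℝ} {f : (Fin d → ℝ) → ℝ} {B : ℝ}
    (hF : ∀ N, Measurable (F N)) (hB : ∀ N x, |F N x| ≤ B)
    (h : ∀ x ∈ S, Filter.Tendsto (fun N => F N x) Filter.atTop (nhds (f x))) :
    Filter.Tendsto (fun N => ∫ x in S, F N x) Filter.atTop (nhds (∫ x in S, f x)) := by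
  refine tendsto_integral_of_dominated_convergence (fun _ => B)
    (fun N => (hF N).aestronglyMeasurable) (integrableOn_const hb.measure_lt_top.ne)
    (fun N => Filter.Eventually.of_forall (hB N)) ?_
  filter_upwards [ae_restrict_mem hS] with x hx using h x hx

lemma sq_setIntegral_abs_le {S : Set (Fin d → ℝ)} (hb : Bornology.IsBounded S)
    {f : (Fin d → ℝ) → ℝ} (hf : Measurable f) {L : ℝ} (hL : ∀ x, |f x| ≤ L) :
    (∫ x in S, |f x|) ^ 2 ≤ volume.real S * ∫ x in S, f x ^ 2 := by
  have ht : volume S ≠ ⊤ := hb.measure_lt_top.ne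
  have hi := (integrableOn_of_bdd hf hL hb).abs
  have hi2 : IntegrableOn (fun x => f x ^ 2) S :=
    integrableOn_of_bdd (hf.pow_const 2) (L := L ^ 2) (fun x => by
      rw [abs_pow]; exact pow_le_pow_left₀ (abs_nonneg _) (hL x) 2) hb
  rcases eq_or_ne (volume S) 0 with h0 | h0
  · simp [Measure.restrict_eq_zero.2 h0]
  have h2 : 0 < volume.real S := ENNReal.toReal_pos h0 ht
  set a := ∫ x in S, |f x|
  set V := volume.real S
  have key : 0 ≤ ∫ x in S, (|f x| - a / V) ^ 2 := integral_nonneg fun x => sq_nonneg _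
  have e : ∀ x, (|f x| - a / V) ^ 2 = f x ^ 2 - 2 * (a / V) * |f x| + (a / V) ^ 2 := fun x => by
    rw [sub_sq, sq_abs]; ring
  simp only [e] at key
  have hi3 : IntegrableOn (fun x => 2 * (a / V) * |f x|) S := hi.const_mul _
  have hi4 : IntegrableOn (fun x => f x ^ 2 - 2 * (a / V) * |f x|) S := hi2.sub hi3
  rw [integral_add hi4 (integrableOn_const ht),
    integral_sub hi2 hi3, integral_const_mul, setIntegral_const, smul_eq_mul] at key
  have : ∫ x in S, f x ^ 2 ≥ a ^ 2 / V := by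
    have e2 : V * (a / V) ^ 2 - 2 * (a / V) * a = - (a ^ 2 / V) := by field_simp; ring
    change 0 ≤ (∫ x in S, f x ^ 2) - 2 * (a / V) * a + V * (a / V) ^ 2 at key
    linarith
  rw [ge_iff_le, div_le_iff₀ h2] at this
  linarith

/-! ### The multiscale square function -/

/-- Weighted sum over all scales below `3 ^ k` of the squared cell averages of a vector field. -/
def sqFun (lam : ℝ) (v : Fin d → (Fin d → ℝ) → ℝ) (k : ℤ) (x : Fin d → ℝ) : ℝ :=
  ∑' i : ℕ, lam ^ i * ∑ l, cellAvg (k - i) (v l) x ^ 2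

section sqFun

variable {lam L : ℝ} {v : Fin d → (Fin d → ℝ) → ℝ}

lemma sum_cellAvg_sq_le (hL : ∀ l x, |v l x| ≤ L) (j : ℤ) (x : Fin d → ℝ) :
    ∑ l, cellAvg j (v l) x ^ 2 ≤ d * L ^ 2 := by
  have h : ∀ l ∈ Finset.univ, cellAvg j (v l) x ^ 2 ≤ L ^ 2 := fun l _ => by
    rw [← sq_abs]
    exact pow_le_pow_left₀ (abs_nonneg _) (abs_cellAvg_le (hL l) j x) 2
  simpa using Finset.sum_le_card_nsmul _ _ _ h

lemma sum_cellAvg_sq_nonneg (v : Fin d → (Fin d → ℝ) → ℝ) (j : ℤ) (x : Fin d → ℝ) :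
    0 ≤ ∑ l, cellAvg j (v l) x ^ 2 := Finset.sum_nonneg fun _ _ => sq_nonneg _

lemma summable_geometric_mul {b : ℕ → ℝ} {B : ℝ} (h0 : 0 ≤ lam) (h1 : lam < 1)
    (hb : ∀ i, 0 ≤ b i) (hB : ∀ i, b i ≤ B) : Summable fun i => lam ^ i * b i :=
  Summable.of_nonneg_of_le (fun i => mul_nonneg (pow_nonneg h0 i) (hb i))
    (fun i => mul_le_mul_of_nonneg_left (hB i) (pow_nonneg h0 i))
    ((summable_geometric_of_lt_one h0 h1).mul_right B)

lemma summable_sqFun (h0 : 0 ≤ lam) (h1 : lam < 1) (hL : ∀ l x, |v l x| ≤ L) (k : ℤ)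
    (x : Fin d → ℝ) : Summable fun i : ℕ => lam ^ i * ∑ l, cellAvg (k - i) (v l) x ^ 2 :=
  summable_geometric_mul h0 h1 (fun _ => sum_cellAvg_sq_nonneg v _ x)
    (fun _ => sum_cellAvg_sq_le hL _ x)

lemma sqFun_nonneg (h0 : 0 ≤ lam) (k : ℤ) (x : Fin d → ℝ) : 0 ≤ sqFun lam v k x :=
  tsum_nonneg fun i => mul_nonneg (pow_nonneg h0 i) (sum_cellAvg_sq_nonneg v _ x)

lemma abs_sqFun_le (h0 : 0 ≤ lam) (h1 : lam < 1) (hL : ∀ l x, |v l x| ≤ L) (k : ℤ)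
    (x : Fin d → ℝ) : |sqFun lam v k x| ≤ (1 - lam)⁻¹ * (d * L ^ 2) := by
  rw [abs_of_nonneg (sqFun_nonneg h0 k x), ← tsum_geometric_of_lt_one h0 h1, ← tsum_mul_right]
  exact (summable_sqFun h0 h1 hL k x).tsum_le_tsum
    (fun i => mul_le_mul_of_nonneg_left (sum_cellAvg_sq_le hL _ x) (pow_nonneg h0 i))
    ((summable_geometric_of_lt_one h0 h1).mul_right _)

lemma measurable_sqFun (h0 : 0 ≤ lam) (h1 : lam < 1) (hL : ∀ l x, |v l x| ≤ L) (k : ℤ) :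
    Measurable (sqFun lam v k) := by
  refine measurable_of_tendsto_metrizable
    (f := fun (N : ℕ) x => ∑ i ∈ Finset.range N, lam ^ i * ∑ l, cellAvg (k - i) (v l) x ^ 2)
    (fun N => ?_) ?_
  · refine Finset.measurable_fun_sum _ fun i _ => Measurable.const_mul ?_ _
    exact Finset.measurable_fun_sum _ fun l _ => (measurable_cellAvg _ _).pow_const 2
  · exact tendsto_pi_nhds.2 fun x => (summable_sqFun h0 h1 hL k x).hasSum.tendsto_sum_nat

lemma integrableOn_sqFun (h0 : 0 ≤ lam) (h1 : lam < 1) (hL : ∀ l x, |v l x| ≤ L) (k : ℤ)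
    {S : Set (Fin d → ℝ)} (hb : Bornology.IsBounded S) : IntegrableOn (sqFun lam v k) S :=
  integrableOn_of_bdd (measurable_sqFun h0 h1 hL k) (abs_sqFun_le h0 h1 hL k) hb

lemma setIntegral_sqFun_nonneg (h0 : 0 ≤ lam) (k : ℤ) (S : Set (Fin d → ℝ)) :
    0 ≤ ∫ x in S, sqFun lam v k x := integral_nonneg fun x => sqFun_nonneg h0 k x

lemma pow_mul_sqFun_sub_le (h0 : 0 ≤ lam) (h1 : lam < 1) (hL : ∀ l x, |v l x| ≤ L) (k : ℤ) (s : ℕ)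
    (x : Fin d → ℝ) : lam ^ s * sqFun lam v (k - s) x ≤ sqFun lam v k x := by
  have hs := summable_sqFun h0 h1 hL k x
  have e := hs.sum_add_tsum_nat_add s
  have e2 : ∑' i : ℕ, lam ^ (i + s) * ∑ l, cellAvg (k - (i + s : ℕ)) (v l) x ^ 2
      = lam ^ s * sqFun lam v (k - s) x := by
    rw [sqFun, ← tsum_mul_left]
    refine tsum_congr fun i => ?_
    rw [pow_add, show k - ((i + s : ℕ) : ℤ) = k - s - i by push_cast; ring]
    ring
  rw [e2] at e
  have : 0 ≤ ∑ i ∈ Finset.range s, lam ^ i * ∑ l, cellAvg (k - i) (v l) x ^ 2 :=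
    Finset.sum_nonneg fun i _ => mul_nonneg (pow_nonneg h0 i) (sum_cellAvg_sq_nonneg v _ x)
  change _ ≤ ∑' i : ℕ, lam ^ i * ∑ l, cellAvg (k - i) (v l) x ^ 2
  linarith

lemma sum_mul_setIntegral_cellAvg_sq_le (h0 : 0 ≤ lam) (h1 : lam < 1) (hL : ∀ l x, |v l x| ≤ L)
    (k : ℤ) {S : Set (Fin d → ℝ)} (hb : Bornology.IsBounded S) (l : Fin d) (N : ℕ) :
    ∑ i ∈ Finset.range N, lam ^ i * ∫ x in S, cellAvg (k - i) (v l) x ^ 2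
      ≤ ∫ x in S, sqFun lam v k x := by
  have hi : ∀ i : ℕ, IntegrableOn (fun x => lam ^ i * cellAvg (k - i) (v l) x ^ 2) S := fun i =>
    (integrableOn_of_bdd ((measurable_cellAvg _ _).pow_const 2) (L := L ^ 2) (fun x => by
      rw [abs_pow]
      exact pow_le_pow_left₀ (abs_nonneg _) (abs_cellAvg_le (hL l) _ x) 2) hb).const_mul _
  simp only [← integral_const_mul]
  rw [← integral_finsetSum _ fun i _ => hi i]
  refine integral_mono (integrable_finsetSum _ fun i _ => hi i)
    (integrableOn_sqFun h0 h1 hL k hb) fun x => ?_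
  refine le_trans (Finset.sum_le_sum fun i _ => ?_)
    ((summable_sqFun h0 h1 hL k x).sum_le_tsum (Finset.range N) fun i _ =>
      mul_nonneg (pow_nonneg h0 i) (sum_cellAvg_sq_nonneg v _ x))
  refine mul_le_mul_of_nonneg_left ?_ (pow_nonneg h0 i)
  exact Finset.single_le_sum (f := fun l => cellAvg (k - i) (v l) x ^ 2)
    (fun _ _ => sq_nonneg _) (Finset.mem_univ l)

end sqFun

/-! ### Testing against tent functions -/

/-- Testing a cell average against a function which is Lipschitz along cells gains a factor
proportional to the side of the cell. -/
lemma abs_setIntegral_cellAvg_mul_le {k : ℤ} {S : Set (Fin d → ℝ)} (hS : IsGridSet k S)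
    (hb : Bornology.IsBounded S) {f g : (Fin d → ℝ) → ℝ} (hf : Measurable f) {L : ℝ}
    (hL : ∀ x, |f x| ≤ L) (hg : Measurable g) (hM : ∀ x, |g x| ≤ 3 ^ k)
    (hω : ∀ j ≤ k, ∀ x y, idx j x = idx j y → |g x - g y| ≤ 2 * 3 ^ j) (N : ℕ) :
    |∫ x in S, cellAvg (k - N) f x * g x|
        + 2 * (3 ^ (k - N) * ∫ x in S, |cellAvg (k - N) f x|)
      ≤ 9 * ∑ i ∈ Finset.range (N + 1), 3 ^ (k - i) * ∫ x in S, |cellAvg (k - i) f x| := by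
  have iE : ∀ j, IntegrableOn (cellAvg j f) S := fun j =>
    integrableOn_of_bdd (measurable_cellAvg j f) (abs_cellAvg_le hL j) hb
  have iEg : ∀ j, IntegrableOn (fun x => cellAvg j f x * g x) S := fun j =>
    integrableOn_of_bdd ((measurable_cellAvg j f).mul hg) (L := L * 3 ^ k) (fun x => by
      rw [Pi.mul_apply, abs_mul]
      exact mul_le_mul (abs_cellAvg_le hL j x) (hM x) (abs_nonneg _)
        ((abs_nonneg _).trans (hL x))) hb
  induction N with
  | zero =>
    simp only [Nat.cast_zero, sub_zero, zero_add, Finset.range_one, Finset.sum_singleton]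
    have h1 : |∫ x in S, cellAvg k f x * g x| ≤ 3 ^ k * ∫ x in S, |cellAvg k f x| := by
      rw [← integral_const_mul]
      refine abs_integral_le_integral_abs.trans
        (integral_mono (iEg k).abs ((iE k).abs.const_mul _) fun x => ?_)
      change |cellAvg k f x * g x| ≤ _
      rw [abs_mul, mul_comm]
      exact mul_le_mul_of_nonneg_right (hM x) (abs_nonneg _)
    have h2 : 0 ≤ 3 ^ k * ∫ x in S, |cellAvg k f x| :=
      mul_nonneg (by positivity) (integral_nonneg fun x => abs_nonneg _)
    linarith
  | succ N ih =>
    rw [Finset.sum_range_succ]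
    set j : ℤ := k - (N : ℤ) with hj
    have e : k - ((N + 1 : ℕ) : ℤ) = j - 1 := by push_cast; ring
    rw [e]
    have hjk : j ≤ k := by omega
    have h3 : (3 : ℝ) ^ j = 3 * 3 ^ (j - 1) := by
      rw [← zpow_one_add₀ (by norm_num)]; congr 1; ring
    have hosc := abs_setIntegral_mul_le_of_osc (hS.of_le hjk) hb
      (f := fun x => cellAvg (j - 1) f x - cellAvg j f x) (L := L + L)
      ((measurable_cellAvg _ _).sub (measurable_cellAvg _ _))
      (fun x => (abs_sub _ _).trans (add_le_add (abs_cellAvg_le hL _ x) (abs_cellAvg_le hL _ x)))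
      hg hM (ω := 2 * 3 ^ j) (fun m _ => by
        have hbm := isBounded_cell j m
        rw [integral_sub (integrableOn_of_bdd (measurable_cellAvg _ f) (abs_cellAvg_le hL _) hbm)
          (integrableOn_of_bdd (measurable_cellAvg _ f) (abs_cellAvg_le hL _) hbm),
          setIntegral_cellAvg ((isGridSet_cell j m).of_le (by omega)) hbm hf hL,
          setIntegral_cellAvg (isGridSet_cell j m) hbm hf hL, sub_self])
      (fun x _ y _ h => hω j hjk x y h)
    have e1 : ∫ x in S, (cellAvg (j - 1) f x - cellAvg j f x) * g x
        = (∫ x in S, cellAvg (j - 1) f x * g x) - ∫ x in S, cellAvg j f x * g x := by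
      simp only [sub_mul]
      exact integral_sub (iEg _) (iEg _)
    have e2 : ∫ x in S, |cellAvg (j - 1) f x - cellAvg j f x|
        ≤ (∫ x in S, |cellAvg (j - 1) f x|) + ∫ x in S, |cellAvg j f x| := by
      rw [← integral_add (iE _).abs (iE _).abs]
      exact integral_mono ((iE _).sub (iE _)).abs ((iE _).abs.add (iE _).abs) fun x => abs_sub _ _
    rw [e1] at hosc
    have h4 := mul_le_mul_of_nonneg_left e2 (show (0 : ℝ) ≤ 2 * 3 ^ j by positivity)
    have h5 := abs_sub_abs_le_abs_sub (∫ x in S, cellAvg (j - 1) f x * g x)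
      (∫ x in S, cellAvg j f x * g x)
    have h6 : 0 ≤ 3 ^ (j - 1) * ∫ x in S, |cellAvg (j - 1) f x| :=
      mul_nonneg (by positivity) (integral_nonneg fun x => abs_nonneg _)
    have h7 : 2 * 3 ^ j * ((∫ x in S, |cellAvg (j - 1) f x|) + ∫ x in S, |cellAvg j f x|)
        = 6 * (3 ^ (j - 1) * ∫ x in S, |cellAvg (j - 1) f x|)
          + 2 * (3 ^ j * ∫ x in S, |cellAvg j f x|) := by
      rw [mul_add, h3]; ring
    rw [h7] at h4
    linarith

/-- Square form of the tested estimate, with constant depending only on the weight `lam`. -/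
lemma sq_setIntegral_mul_le {lam L : ℝ} {v : Fin d → (Fin d → ℝ) → ℝ} (h9 : 1 / 9 < lam)
    (h1 : lam < 1) (hvm : ∀ l, Measurable (v l)) (hL : ∀ l x, |v l x| ≤ L) {k : ℤ}
    {S : Set (Fin d → ℝ)} (hS : IsGridSet k S) (hb : Bornology.IsBounded S) {g : (Fin d → ℝ) → ℝ}
    (hg : Measurable g) (hM : ∀ x, |g x| ≤ 3 ^ k)
    (hω : ∀ j ≤ k, ∀ x y, idx j x = idx j y → |g x - g y| ≤ 2 * 3 ^ j) (l : Fin d)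
    (hc : ContinuousOn (v l) S) :
    (∫ x in S, v l x * g x) ^ 2 ≤ 81 * (1 - (9 * lam)⁻¹)⁻¹ * 9 ^ k *
      (volume.real S * ∫ x in S, sqFun lam v k x) := by
  have h0 : 0 < lam := by linarith
  have hr0 : 0 ≤ (9 * lam)⁻¹ := by positivity
  have hr1 : (9 * lam)⁻¹ < 1 := inv_lt_one_of_one_lt₀ (by linarith)
  have hlim : Filter.Tendsto (fun N : ℕ => (∫ x in S, cellAvg (k - N) (v l) x * g x) ^ 2)
      Filter.atTop (nhds ((∫ x in S, v l x * g x) ^ 2)) := by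
    refine Filter.Tendsto.pow (tendsto_setIntegral_of_bdd hS.measurableSet hb (B := L * 3 ^ k)
      (fun N => (measurable_cellAvg _ _).mul hg) (fun N x => ?_) fun x hx => ?_) 2
    · rw [Pi.mul_apply, abs_mul]
      exact mul_le_mul (abs_cellAvg_le (hL l) _ x) (hM x) (abs_nonneg _)
        ((abs_nonneg _).trans (hL l x))
    · exact (tendsto_cellAvg hS (hvm l) (hL l) hc hx).mul_const _
  refine le_of_tendsto' hlim fun N => ?_
  set A : ℕ → ℝ := fun i => ∫ x in S, |cellAvg (k - i) (v l) x| with hA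
  have hA0 : ∀ i, 0 ≤ A i := fun i => integral_nonneg fun x => abs_nonneg _
  have b1 := abs_setIntegral_cellAvg_mul_le hS hb (hvm l) (hL l) hg hM hω N
  have b2 : |∫ x in S, cellAvg (k - N) (v l) x * g x|
      ≤ 9 * 3 ^ k * ∑ i ∈ Finset.range (N + 1), (1 / 3) ^ i * A i := by
    have : 0 ≤ 2 * (3 ^ (k - (N : ℤ)) * ∫ x in S, |cellAvg (k - N) (v l) x|) :=
      mul_nonneg (by norm_num) (mul_nonneg (by positivity) (hA0 N))
    refine ((le_add_of_nonneg_right this).trans b1).trans (le_of_eq ?_)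
    rw [mul_assoc]
    congr 1
    rw [Finset.mul_sum]
    refine Finset.sum_congr rfl fun i _ => ?_
    rw [zpow_sub₀ (by norm_num), zpow_natCast, one_div, inv_pow]
    simp only [hA]; ring
  have cs := Finset.sum_mul_sq_le_sq_mul_sq (Finset.range (N + 1))
    (fun i => √((9 * lam)⁻¹) ^ i) (fun i => √lam ^ i * A i)
  have e1 : ∀ i : ℕ, √((9 * lam)⁻¹) ^ i * (√lam ^ i * A i) = (1 / 3) ^ i * A i := fun i => by
    rw [← mul_assoc, ← mul_pow, ← Real.sqrt_mul hr0,
      show (9 * lam)⁻¹ * lam = (1 / 3) ^ 2 by field_simp; norm_num, Real.sqrt_sq (by norm_num)]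
  have e2 : ∀ i : ℕ, (√((9 * lam)⁻¹) ^ i) ^ 2 = (9 * lam)⁻¹ ^ i := fun i => by
    rw [← pow_mul, mul_comm i, pow_mul, Real.sq_sqrt hr0]
  have e3 : ∀ i : ℕ, (√lam ^ i * A i) ^ 2 = lam ^ i * A i ^ 2 := fun i => by
    rw [mul_pow, ← pow_mul, mul_comm i, pow_mul, Real.sq_sqrt h0.le]
  simp only [e1, e2, e3] at cs
  have g1 : ∑ i ∈ Finset.range (N + 1), (9 * lam)⁻¹ ^ i ≤ (1 - (9 * lam)⁻¹)⁻¹ := by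
    rw [← tsum_geometric_of_lt_one hr0 hr1]
    exact (summable_geometric_of_lt_one hr0 hr1).sum_le_tsum _ fun i _ => pow_nonneg hr0 i
  have g2 : ∑ i ∈ Finset.range (N + 1), lam ^ i * A i ^ 2
      ≤ volume.real S * ∫ x in S, sqFun lam v k x := by
    refine le_trans ?_ (mul_le_mul_of_nonneg_left
      (sum_mul_setIntegral_cellAvg_sq_le h0.le h1 hL k hb l (N + 1)) measureReal_nonneg)
    rw [Finset.mul_sum]
    refine Finset.sum_le_sum fun i _ => ?_
    rw [mul_left_comm]
    exact mul_le_mul_of_nonneg_left (sq_setIntegral_abs_le hb (measurable_cellAvg _ _)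
      (abs_cellAvg_le (hL l) _)) (pow_nonneg h0.le i)
  have g3 : (∑ i ∈ Finset.range (N + 1), (1 / 3) ^ i * A i) ^ 2
      ≤ (1 - (9 * lam)⁻¹)⁻¹ * (volume.real S * ∫ x in S, sqFun lam v k x) :=
    cs.trans (mul_le_mul g1 g2
      (Finset.sum_nonneg fun i _ => mul_nonneg (pow_nonneg h0.le i) (sq_nonneg _))
      (inv_nonneg.2 (by linarith)))
  have h9k : (9 : ℝ) ^ k = 3 ^ k * 3 ^ k := by rw [← mul_zpow]; norm_num
  calc (∫ x in S, cellAvg (k - N) (v l) x * g x) ^ 2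
      ≤ (9 * 3 ^ k * ∑ i ∈ Finset.range (N + 1), (1 / 3) ^ i * A i) ^ 2 := by
        rw [← sq_abs]; exact pow_le_pow_left₀ (abs_nonneg _) b2 2
    _ = 81 * 9 ^ k * (∑ i ∈ Finset.range (N + 1), (1 / 3) ^ i * A i) ^ 2 := by
        rw [h9k]; ring
    _ ≤ 81 * 9 ^ k * ((1 - (9 * lam)⁻¹)⁻¹ * (volume.real S * ∫ x in S, sqFun lam v k x)) :=
        mul_le_mul_of_nonneg_left g3 (by positivity)
    _ = _ := by ring

/-- The measure of the set of times `s ∈ (0, w]` at which the translate of the cell `(k, m)` by `s`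
in the direction `i` contains `y`. -/
def tent (k : ℤ) (m : Fin d → ℤ) (i : Fin d) (w : ℝ) (y : Fin d → ℝ) : ℝ :=
  if ∀ l, l ≠ i → idx k y l = m l then
    max 0 (min w (y i - (3 ^ k * m i - 3 ^ k / 2)) -
      max 0 (y i - (3 ^ k * m i - 3 ^ k / 2) - 3 ^ k))
  else 0

lemma measurable_tent (k : ℤ) (m : Fin d → ℤ) (i : Fin d) (w : ℝ) : Measurable (tent k m i w) := by
  refine Measurable.ite ?_ (by fun_prop) measurable_const
  exact measurable_idx k (MeasurableSet.of_discrete (s := {a | ∀ l, l ≠ i → a l = m l}))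

lemma abs_tent_le (k : ℤ) (m : Fin d → ℤ) (i : Fin d) (w : ℝ) (y : Fin d → ℝ) :
    |tent k m i w y| ≤ 3 ^ k := by
  have h3 : (0 : ℝ) < 3 ^ k := by positivity
  rw [tent]
  split_ifs
  · rw [abs_of_nonneg (le_max_left _ _)]
    refine max_le h3.le ?_
    have h1 := min_le_right w (y i - (3 ^ k * m i - 3 ^ k / 2))
    have h2 := le_max_right 0 (y i - (3 ^ k * m i - 3 ^ k / 2) - 3 ^ k)
    linarith
  · simpa using h3.le

lemma tent_osc (k : ℤ) (m : Fin d → ℤ) (i : Fin d) (w : ℝ) (j : ℤ) (hj : j ≤ k)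
    (x y : Fin d → ℝ) (h : idx j x = idx j y) : |tent k m i w x - tent k m i w y| ≤ 2 * 3 ^ j := by
  have hk := idx_eq_of_le hj h
  have hd : |x i - y i| ≤ 3 ^ j := (dist_le_pi_dist x y i).trans (dist_le_of_idx_eq h)
  rw [tent, tent, hk]
  split_ifs
  · set b := 3 ^ k * (m i : ℝ) - 3 ^ k / 2
    have h1 := abs_max_sub_max_le_max 0 (min w (x i - b) - max 0 (x i - b - 3 ^ k)) 0
      (min w (y i - b) - max 0 (y i - b - 3 ^ k))
    have h2 := abs_min_sub_min_le_max w (x i - b) w (y i - b)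
    have h3 := abs_max_sub_max_le_max 0 (x i - b - 3 ^ k) 0 (y i - b - 3 ^ k)
    have e1 : x i - b - (y i - b) = x i - y i := by ring
    have e2 : x i - b - 3 ^ k - (y i - b - 3 ^ k) = x i - y i := by ring
    rw [e1, sub_self, abs_zero, max_eq_right (abs_nonneg (x i - y i))] at h2
    rw [e2, sub_self, abs_zero, max_eq_right (abs_nonneg (x i - y i))] at h3
    refine h1.trans ?_
    rw [sub_self, abs_zero]
    refine max_le (by positivity) ?_
    rw [sub_sub_sub_comm]
    exact (abs_sub _ _).trans (by linarith)
  · rw [sub_self, abs_zero]; positivity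

lemma mem_of_tent_ne_zero {k : ℤ} {m : Fin d → ℤ} {i : Fin d} {a : ℤ} {y : Fin d → ℝ}
    (h : tent k m i (a * 3 ^ k) y ≠ 0) :
    (∀ l, l ≠ i → idx k y l = m l) ∧ m i ≤ idx k y i ∧ idx k y i ≤ m i + a := by
  have h3 : (0 : ℝ) < 3 ^ k := by positivity
  rw [tent] at h
  split_ifs at h with hl
  · refine ⟨hl, ?_⟩
    obtain ⟨h1, h2⟩ := (idx_eq_iff k y i _).1 rfl
    set b := 3 ^ k * (m i : ℝ) - 3 ^ k / 2 with hb
    have hpos : 0 < min ((a : ℝ) * 3 ^ k) (y i - b) - max 0 (y i - b - 3 ^ k) := by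
      by_contra hn
      exact h (max_eq_left (not_lt.1 hn))
    have p1 := min_le_left ((a : ℝ) * 3 ^ k) (y i - b)
    have p2 := min_le_right ((a : ℝ) * 3 ^ k) (y i - b)
    have p3 := le_max_left 0 (y i - b - 3 ^ k)
    have p4 := le_max_right 0 (y i - b - 3 ^ k)
    constructor
    · have : (m i : ℝ) < idx k y i + 1 := by
        by_contra hn; push Not at hn; nlinarith
      exact Int.lt_add_one_iff.1 (by exact_mod_cast this)
    · have : (idx k y i : ℝ) < m i + a + 1 := by
        by_contra hn; push Not at hn; nlinarith
      exact Int.lt_add_one_iff.1 (by exact_mod_cast this)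
  · exact absurd rfl h

lemma integral_indicator_sub_single (k : ℤ) (m : Fin d → ℤ) (i : Fin d) (w : ℝ)
    (y : Fin d → ℝ) :
    ∫ s in Set.Ioc 0 w, (cell k m).indicator (fun _ => (1 : ℝ)) (y - Pi.single i s)
      = tent k m i w y := by
  rw [tent]
  split_ifs with hl
  · set b := 3 ^ k * (m i : ℝ) - 3 ^ k / 2 with hb
    have e : ∀ s, (cell k m).indicator (fun _ => (1 : ℝ)) (y - Pi.single i s)
        = (Set.Ioc (y i - b - 3 ^ k) (y i - b)).indicator (fun _ => (1 : ℝ)) s := fun s => by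
      have hiff : y - Pi.single i s ∈ cell k m ↔ s ∈ Set.Ioc (y i - b - 3 ^ k) (y i - b) := by
        have hi := idx_eq_iff k (y - Pi.single i s) i (m i)
        rw [Pi.sub_apply, Pi.single_eq_same] at hi
        constructor
        · intro hx
          obtain ⟨h1, h2⟩ := hi.1 (congrFun hx i)
          constructor <;> rw [hb] <;> linarith
        · rintro ⟨h1, h2⟩
          funext l
          rcases eq_or_ne l i with rfl | hli
          · rw [hb] at h1 h2
            exact hi.2 ⟨by linarith, by linarith⟩
          · rw [← hl l hli]
            simp [idx, hli]
      by_cases hs : s ∈ Set.Ioc (y i - b - 3 ^ k) (y i - b)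
      · rw [Set.indicator_of_mem hs, Set.indicator_of_mem (hiff.2 hs)]
      · rw [Set.indicator_of_notMem hs, Set.indicator_of_notMem (mt hiff.1 hs)]
    simp only [e]
    rw [setIntegral_indicator measurableSet_Ioc, setIntegral_const, Set.Ioc_inter_Ioc, smul_eq_mul,
      mul_one, Real.volume_real_Ioc, max_comm]
  · push Not at hl
    obtain ⟨l, hli, hne⟩ := hl
    have e : ∀ s, (cell k m).indicator (fun _ => (1 : ℝ)) (y - Pi.single i s) = 0 := fun s => by
      refine Set.indicator_of_notMem (fun hx => hne ?_) _
      have := congrFun hx l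
      rw [← this]
      simp [idx, hli]
    simp [e]

/-- Averaging translates of a cell amounts to testing against the tent function. -/
lemma integral_cell_integral_translate (k : ℤ) (m : Fin d → ℤ) (i : Fin d) (w : ℝ)
    {f : (Fin d → ℝ) → ℝ} (hf : Measurable f) {L : ℝ} (hL : ∀ x, |f x| ≤ L) :
    ∫ x in cell k m, ∫ s in Set.Ioc 0 w, f (x + Pi.single i s) = ∫ y, f y * tent k m i w y := by
  set ν : Measure ℝ := volume.restrict (Set.Ioc 0 w)
  set χ : (Fin d → ℝ) → ℝ := (cell k m).indicator fun _ => (1 : ℝ) with hχ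
  have hχm : Measurable χ := measurable_const.indicator (measurableSet_cell k m)
  have hsm : Measurable fun p : (Fin d → ℝ) × ℝ => (Pi.single i p.2 : Fin d → ℝ) :=
    (continuous_single (A := fun _ : Fin d => ℝ) i).measurable.comp measurable_snd
  have hL0 : 0 ≤ L := (abs_nonneg _).trans (hL 0)
  have hχi : Integrable χ := (integrable_indicator_iff (measurableSet_cell k m)).2
    (integrableOn_const (volume_cell_lt_top k m).ne)
  have hχ1 : ∀ x, ‖χ x‖ = χ x := fun x => by
    rw [Real.norm_eq_abs, abs_of_nonneg]
    exact Set.indicator_nonneg (fun _ _ => zero_le_one) x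
  have int1 : Integrable (fun p : (Fin d → ℝ) × ℝ => χ p.1 * f (p.1 + Pi.single i p.2))
      (volume.prod ν) := by
    refine ((hχi.mul_const L).comp_fst ν).mono' ?_ (Filter.Eventually.of_forall fun p => ?_)
    · exact ((hχm.comp measurable_fst).mul
        (hf.comp (measurable_fst.add hsm))).aestronglyMeasurable
    · rw [norm_mul, hχ1]
      exact mul_le_mul_of_nonneg_left (hL _) ((norm_nonneg _).trans_eq (hχ1 _))
  set B : Set (Fin d → ℝ) := hbox (fun l => 3 ^ k * (m l : ℝ)) (3 ^ k + 2 * |w| + 1)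
  have hBm : MeasurableSet B := MeasurableSet.univ_pi fun i => measurableSet_Ico
  have hBi : Integrable (B.indicator fun _ => L) := (integrable_indicator_iff hBm).2
    (integrableOn_const (volume_hbox_lt_top _ _).ne)
  have int2 : Integrable (fun p : (Fin d → ℝ) × ℝ => χ (p.1 - Pi.single i p.2) * f p.1)
      (volume.prod ν) := by
    refine (hBi.comp_fst ν).mono' ?_ ?_
    · exact ((hχm.comp (measurable_fst.sub hsm)).mul
        (hf.comp measurable_fst)).aestronglyMeasurable
    · have hae : ∀ᵐ p ∂((volume : Measure (Fin d → ℝ)).prod ν), p.2 ∈ Set.Ioc 0 w := by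
        have h1 : ∀ᵐ s ∂ν, s ∈ Set.Ioc 0 w := ae_restrict_mem measurableSet_Ioc
        exact Measure.quasiMeasurePreserving_snd.ae h1
      filter_upwards [hae] with p hp
      by_cases hx : p.1 - Pi.single i p.2 ∈ cell k m
      · have hpB : p.1 ∈ B := by
          rw [cell_eq_hbox] at hx
          intro l _
          have hl := hx l trivial
          have hw := le_abs_self w
          have hsl : 0 ≤ (Pi.single i p.2 : Fin d → ℝ) l
              ∧ (Pi.single i p.2 : Fin d → ℝ) l ≤ w := by
            rcases eq_or_ne l i with rfl | hli
            · rw [Pi.single_eq_same]; exact ⟨hp.1.le, hp.2⟩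
            · rw [Pi.single_eq_of_ne hli]; exact ⟨le_rfl, hp.1.le.trans hp.2⟩
          simp only [Pi.sub_apply, Set.mem_Ico] at hl
          constructor <;> linarith [hl.1, hl.2, hsl.1, hsl.2]
        rw [Set.indicator_of_mem hpB, hχ, Set.indicator_of_mem hx, one_mul]
        exact hL _
      · rw [hχ, Set.indicator_of_notMem hx, zero_mul, norm_zero]
        exact Set.indicator_nonneg (fun _ _ => hL0) _
  calc ∫ x in cell k m, ∫ s in Set.Ioc 0 w, f (x + Pi.single i s)
      = ∫ x, ∫ s, χ x * f (x + Pi.single i s) ∂ν := by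
        rw [← integral_indicator (measurableSet_cell k m)]
        refine integral_congr_ae (Filter.Eventually.of_forall fun x => ?_)
        by_cases hx : x ∈ cell k m
        · simp [hχ, hx, ν]
        · simp [hχ, hx]
    _ = ∫ s, (∫ x, χ x * f (x + Pi.single i s)) ∂ν := integral_integral_swap int1
    _ = ∫ s, (∫ y, χ (y - Pi.single i s) * f y) ∂ν := by
        refine integral_congr_ae (Filter.Eventually.of_forall fun s => ?_)
        have := integral_add_right_eq_self (μ := (volume : Measure (Fin d → ℝ)))
          (fun y => χ (y - Pi.single i s) * f y) (Pi.single i s)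
        simp only [add_sub_cancel_right] at this
        exact this
    _ = ∫ y, ∫ s, χ (y - Pi.single i s) * f y ∂ν := (integral_integral_swap int2).symm
    _ = ∫ y, f y * tent k m i w y := by
        refine integral_congr_ae (Filter.Eventually.of_forall fun y => ?_)
        simp only
        rw [integral_mul_const, mul_comm, integral_indicator_sub_single]

/-! ### Multiscale Poincaré inequality -/

/-- `u` is a bounded potential on `S` of the bounded vector field `v`. -/
structure IsPotentialOn (S : Set (Fin d → ℝ)) (v : Fin d → (Fin d → ℝ) → ℝ)
    (u : (Fin d → ℝ) → ℝ) (L : ℝ) : Prop where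
  measurable_u : Measurable u
  measurable_v : ∀ l, Measurable (v l)
  abs_u_le : ∀ x, |u x| ≤ L
  abs_v_le : ∀ l x, |v l x| ≤ L
  continuousOn_u : ContinuousOn u S
  continuousOn_v : ∀ l, ContinuousOn (v l) S
  ftc : ∀ x ∈ S, ∀ (i : Fin d) (s : ℝ), 0 ≤ s → x + Pi.single i s ∈ S →
    u (x + Pi.single i s) - u x = ∫ r in (0 : ℝ)..s, v i (x + Pi.single i r)

lemma idx_add_single (k : ℤ) (x : Fin d → ℝ) (i : Fin d) (a : ℤ) :
    idx k (x + Pi.single i ((a : ℝ) * 3 ^ k)) = Function.update (idx k x) i (idx k x i + a) := by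
  have h3 : (3 : ℝ) ^ k ≠ 0 := by positivity
  funext l
  rcases eq_or_ne l i with rfl | hli
  · rw [Function.update_self, idx_eq_iff, Pi.add_apply, Pi.single_eq_same]
    obtain ⟨h1, h2⟩ := (idx_eq_iff k x l _).1 rfl
    push_cast
    constructor <;> linarith
  · rw [Function.update_of_ne hli]
    simp [idx, hli]

lemma setIntegral_cell_update (k : ℤ) (m : Fin d → ℤ) (i : Fin d) (a : ℤ)
    (u : (Fin d → ℝ) → ℝ) :
    ∫ x in cell k (Function.update m i (m i + a)), u x
      = ∫ x in cell k m, u (x + Pi.single i ((a : ℝ) * 3 ^ k)) := by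
  rw [← integral_indicator (measurableSet_cell _ _), ← integral_indicator (measurableSet_cell _ _),
    ← integral_add_right_eq_self _ (Pi.single i ((a : ℝ) * 3 ^ k))]
  refine integral_congr_ae (Filter.Eventually.of_forall fun x => ?_)
  have h : x + Pi.single i ((a : ℝ) * 3 ^ k) ∈ cell k (Function.update m i (m i + a))
      ↔ x ∈ cell k m := by
    change idx k _ = _ ↔ idx k x = m
    rw [idx_add_single]
    constructor
    · intro h
      funext l
      have hl := congrFun h l
      rcases eq_or_ne l i with rfl | hli
      · simpa using hl
      · simpa [hli] using hl
    · rintro rfl; rfl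
  by_cases hx : x ∈ cell k m
  · rw [Set.indicator_of_mem hx]
    exact Set.indicator_of_mem (h.2 hx) u
  · rw [Set.indicator_of_notMem hx]
    exact Set.indicator_of_notMem (mt h.1 hx) u

section Poincare

variable {lam L : ℝ} {v : Fin d → (Fin d → ℝ) → ℝ} {u : (Fin d → ℝ) → ℝ}

lemma mem_block_of_idx {k : ℤ} {c m : Fin d → ℤ} (hm : ∀ l, |m l - c l| ≤ 1) {x : Fin d → ℝ}
    (hx : x ∈ cell k m) : x ∈ block k c := fun l => by
  rw [show idx k x = m from hx]; exact hm l

lemma sq_sub_update_le (h9 : 1 / 9 < lam) (h1 : lam < 1) {k : ℤ} {c : Fin d → ℤ}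
    (hu : IsPotentialOn (block k c) v u L) {m : Fin d → ℤ} (hm : ∀ l, |m l - c l| ≤ 1) (i : Fin d)
    {a : ℤ} (ha : 0 ≤ a) (hma : |m i + a - c i| ≤ 1) :
    ((⨍ x in cell k (Function.update m i (m i + a)), u x) - ⨍ x in cell k m, u x) ^ 2
      ≤ 81 * 9 ^ d * (1 - (9 * lam)⁻¹)⁻¹ * 9 ^ k * ⨍ x in block k c, sqFun lam v k x := by
  have hw : 0 ≤ (a : ℝ) * 3 ^ k := mul_nonneg (by exact_mod_cast ha) (by positivity)
  set w := (a : ℝ) * 3 ^ k with hwdef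
  have hbm := isBounded_cell k m
  have iu : IntegrableOn u (cell k m) := integrableOn_of_bdd hu.measurable_u hu.abs_u_le hbm
  have iu' : IntegrableOn (fun x => u (x + Pi.single i w)) (cell k m) :=
    integrableOn_of_bdd (hu.measurable_u.comp (measurable_id.add_const _))
      (fun x => hu.abs_u_le _) hbm
  have e1 : (∫ x in cell k (Function.update m i (m i + a)), u x) - ∫ x in cell k m, u x
      = ∫ y in block k c, v i y * tent k m i w y := by
    rw [setIntegral_cell_update, ← integral_sub iu' iu]
    have e2 : ∫ x in cell k m, (u (x + Pi.single i w) - u x)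
        = ∫ x in cell k m, ∫ s in Set.Ioc 0 w, v i (x + Pi.single i s) := by
      refine setIntegral_congr_fun (measurableSet_cell k m) fun x hx => ?_
      have hxQ : x + Pi.single i w ∈ block k c := by
        intro l
        rw [hwdef, idx_add_single, show idx k x = m from hx]
        rcases eq_or_ne l i with rfl | hli
        · rwa [Function.update_self]
        · rw [Function.update_of_ne hli]; exact hm l
      rw [hu.ftc x (mem_block_of_idx hm hx) i w hw hxQ, intervalIntegral.integral_of_le hw]
    rw [e2, integral_cell_integral_translate k m i w (hu.measurable_v i) (hu.abs_v_le i)]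
    refine (setIntegral_eq_integral_of_forall_compl_eq_zero fun y hy => ?_).symm
    by_contra hne
    refine hy ?_
    obtain ⟨g1, g2, g3⟩ := mem_of_tent_ne_zero (right_ne_zero_of_mul hne)
    intro l
    rcases eq_or_ne l i with rfl | hli
    · have := hm l
      rw [abs_le] at *
      omega
    · rw [g1 l hli]; exact hm l
  have key := sq_setIntegral_mul_le h9 h1 hu.measurable_v hu.abs_v_le (isGridSet_block k c)
    (isBounded_block k c) (measurable_tent k m i w) (abs_tent_le k m i w)
    (tent_osc k m i w) i (hu.continuousOn_v i)
  rw [← e1] at key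
  rw [setAverage_eq, setAverage_eq, setAverage_eq, volume_real_cell, volume_real_cell,
    volume_real_block, smul_eq_mul, smul_eq_mul, smul_eq_mul, ← mul_sub, mul_pow]
  rw [volume_real_block] at key
  set V : ℝ := (3 ^ k) ^ d with hV
  have hV0 : 0 < V := by positivity
  have hVV : ((3 : ℝ) ^ (k + 1)) ^ d = 3 ^ d * V := by
    rw [zpow_add₀ (by norm_num), mul_pow, hV]; ring
  rw [hVV] at key ⊢
  refine (mul_le_mul_of_nonneg_left key (sq_nonneg V⁻¹)).trans (le_of_eq ?_)
  have h99 : (9 : ℝ) ^ d = 3 ^ d * 3 ^ d := by rw [← mul_pow]; norm_num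
  rw [h99]
  field_simp

lemma sq_sub_cellAvg_le (h9 : 1 / 9 < lam) (h1 : lam < 1) {k : ℤ} {c : Fin d → ℤ}
    (hu : IsPotentialOn (block k c) v u L) {x y : Fin d → ℝ} (hx : x ∈ block k c)
    (hy : y ∈ block k c) :
    (cellAvg k u x - cellAvg k u y) ^ 2
      ≤ d ^ 2 * (81 * 9 ^ d * (1 - (9 * lam)⁻¹)⁻¹ * 9 ^ k * ⨍ x in block k c, sqFun lam v k x) := by
  set T := 81 * 9 ^ d * (1 - (9 * lam)⁻¹)⁻¹ * 9 ^ k * ⨍ x in block k c, sqFun lam v k x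
  set U : (Fin d → ℤ) → ℝ := fun m => ⨍ x in cell k m, u x with hU
  have step : ∀ m : Fin d → ℤ, (∀ l, |m l - c l| ≤ 1) → ∀ (i : Fin d) (b : ℤ), |b - c i| ≤ 1 →
      |U (Function.update m i b) - U m| ≤ √T := by
    intro m hm i b hb
    refine Real.abs_le_sqrt ?_
    rcases le_total (m i) b with hle | hle
    · have := sq_sub_update_le h9 h1 hu hm i (a := b - m i) (by omega) (by simpa using hb)
      rw [add_sub_cancel] at this
      exact this
    · have := sq_sub_update_le h9 h1 hu (m := Function.update m i b) (fun l => by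
        rcases eq_or_ne l i with rfl | hli
        · simpa using hb
        · rw [Function.update_of_ne hli]; exact hm l) i (a := m i - b) (by omega)
        (by simpa using hm i)
      rw [Function.update_self, add_sub_cancel, Function.update_idem, Function.update_eq_self] at this
      rw [← neg_sq, neg_sub]
      exact this
  have path : ∀ (m m' : Fin d → ℤ), (∀ l, |m l - c l| ≤ 1) → (∀ l, |m' l - c l| ≤ 1) →
      ∀ s : Finset (Fin d), |U (s.piecewise m m') - U m'| ≤ s.card * √T := by
    intro m m' hm hm' s
    induction s using Finset.induction_on with
    | empty => simp
    | insert i s his ih =>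
      rw [Finset.piecewise_insert, Finset.card_insert_of_notMem his]
      have := step (s.piecewise m m') (fun l => by
        rcases Finset.piecewise_cases s m m' (fun a => |a - c l| ≤ 1) (hm l) (hm' l) with h
        exact h) i (m i) (hm i)
      have tri := abs_sub_le (U (Function.update (s.piecewise m m') i (m i)))
        (U (s.piecewise m m')) (U m')
      push_cast
      linarith
  have hT : 0 ≤ T := by
    have hr1 : (9 * lam)⁻¹ < 1 := inv_lt_one_of_one_lt₀ (by linarith)
    refine mul_nonneg (mul_nonneg (mul_nonneg (by positivity)
      (inv_nonneg.2 (by linarith))) (by positivity)) ?_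
    rw [setAverage_eq]
    exact smul_nonneg (by positivity) (setIntegral_sqFun_nonneg (by linarith) k _)
  have fin := path (idx k x) (idx k y) hx hy Finset.univ
  rw [Finset.piecewise_univ, Finset.card_univ, Fintype.card_fin] at fin
  have := pow_le_pow_left₀ (abs_nonneg _) fin 2
  rwa [sq_abs, mul_pow, Real.sq_sqrt hT] at this

end Poincare

lemma IsPotentialOn.mono {S T : Set (Fin d → ℝ)} {v : Fin d → (Fin d → ℝ) → ℝ}
    {u : (Fin d → ℝ) → ℝ} {L : ℝ} (hu : IsPotentialOn S v u L) (h : T ⊆ S) :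
    IsPotentialOn T v u L where
  measurable_u := hu.measurable_u
  measurable_v := hu.measurable_v
  abs_u_le := hu.abs_u_le
  abs_v_le := hu.abs_v_le
  continuousOn_u := hu.continuousOn_u.mono h
  continuousOn_v := fun l => (hu.continuousOn_v l).mono h
  ftc := fun x hx i s hs hxs => hu.ftc x (h hx) i s hs (h hxs)

/-- The constant in the one-step Poincaré inequality. -/
def stepConst (d : ℕ) (lam : ℝ) : ℝ := d ^ 2 * (81 * 9 ^ d * (1 - (9 * lam)⁻¹)⁻¹)

lemma one_sub_inv_pos {lam : ℝ} (h9 : 1 / 9 < lam) : 0 < 1 - (9 * lam)⁻¹ :=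
  sub_pos.2 (inv_lt_one_of_one_lt₀ (by linarith))

lemma stepConst_nonneg {lam : ℝ} (h9 : 1 / 9 < lam) : 0 ≤ stepConst d lam := by
  have := one_sub_inv_pos h9
  rw [stepConst]; positivity

lemma integrableOn_sq {f : (Fin d → ℝ) → ℝ} (hf : Measurable f) {L : ℝ}
    (hL : ∀ x, |f x| ≤ L) {S : Set (Fin d → ℝ)} (hb : Bornology.IsBounded S) :
    IntegrableOn (fun x => f x ^ 2) S :=
  integrableOn_of_bdd (hf.pow_const 2) (L := L ^ 2) (fun x => by
    rw [abs_pow]; exact pow_le_pow_left₀ (abs_nonneg _) (hL x) 2) hb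

/-- Orthogonality of `u - cellAvg j u` to functions that are constant on cells. -/
lemma setIntegral_sq_sub_eq_add {j : ℤ} {S : Set (Fin d → ℝ)} (hS : IsGridSet j S)
    (hb : Bornology.IsBounded S) {u g : (Fin d → ℝ) → ℝ} (hu : Measurable u) {L : ℝ}
    (hL : ∀ x, |u x| ≤ L) (hg : Measurable g) {M : ℝ} (hM : ∀ x, |g x| ≤ M)
    (hgc : ∀ x y, idx j x = idx j y → g x = g y) :
    ∫ x in S, (u x - g x) ^ 2
      = (∫ x in S, (u x - cellAvg j u x) ^ 2) + ∫ x in S, (cellAvg j u x - g x) ^ 2 := by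
  have mA := measurable_cellAvg j u
  have bA := abs_cellAvg_le hL j
  have m1 : Measurable fun x => u x - cellAvg j u x := hu.sub mA
  have m2 : Measurable fun x => cellAvg j u x - g x := mA.sub hg
  have b1 : ∀ x, |u x - cellAvg j u x| ≤ L + L := fun x =>
    (abs_sub _ _).trans (add_le_add (hL x) (bA x))
  have b2 : ∀ x, |cellAvg j u x - g x| ≤ L + M := fun x =>
    (abs_sub _ _).trans (add_le_add (bA x) (hM x))
  have cross : ∫ x in S, (u x - cellAvg j u x) * (cellAvg j u x - g x) = 0 := by
    have := abs_setIntegral_mul_le_of_osc hS hb m1 b1 m2 b2 (ω := 0) (fun m hm => by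
      rw [integral_sub (integrableOn_of_bdd hu hL (hb.subset hm))
        (integrableOn_of_bdd mA bA (hb.subset hm)), setIntegral_cell_cellAvg, sub_self])
      (fun x _ y _ h => by
        rw [show cellAvg j u x = cellAvg j u y by rw [cellAvg, cellAvg, h], hgc x y h, sub_self,
          abs_zero])
    rw [zero_mul] at this
    exact abs_nonpos_iff.1 this
  have i12 : IntegrableOn (fun x => (u x - cellAvg j u x) * (cellAvg j u x - g x)) S :=
    integrableOn_of_bdd (m1.mul m2) (L := (L + L) * (L + M)) (fun x => by
      rw [Pi.mul_apply, abs_mul]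
      exact mul_le_mul (b1 x) (b2 x) (abs_nonneg _) ((abs_nonneg _).trans (b1 x))) hb
  have e : ∀ x, (u x - g x) ^ 2 = (u x - cellAvg j u x) ^ 2 + (cellAvg j u x - g x) ^ 2
      + 2 * ((u x - cellAvg j u x) * (cellAvg j u x - g x)) := fun x => by ring
  have i1 := integrableOn_sq m1 b1 hb
  have i2 := integrableOn_sq m2 b2 hb
  have i3 : IntegrableOn (fun x => (u x - cellAvg j u x) ^ 2 + (cellAvg j u x - g x) ^ 2) S :=
    i1.add i2
  simp only [e]
  rw [integral_add i3 (i12.const_mul 2), integral_add i1 i2, integral_const_mul, cross, mul_zero,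
    add_zero]

section Poincare

variable {lam L : ℝ} {v : Fin d → (Fin d → ℝ) → ℝ} {u : (Fin d → ℝ) → ℝ}

lemma setAverage_block_cellAvg (hu : Measurable u) (hL : ∀ x, |u x| ≤ L) (k : ℤ)
    (c : Fin d → ℤ) : ⨍ x in block k c, cellAvg k u x = ⨍ x in block k c, u x := by
  rw [setAverage_eq, setAverage_eq,
    setIntegral_cellAvg (isGridSet_block k c) (isBounded_block k c) hu hL]

lemma volume_block_ne_zero (k : ℤ) (c : Fin d → ℤ) : volume (block k c) ≠ 0 := by
  intro h
  have h1 := volume_real_block k c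
  rw [Measure.real, h, ENNReal.toReal_zero] at h1
  have : (0 : ℝ) < (3 ^ (k + 1)) ^ d := by positivity
  linarith

lemma setIntegral_block_cellAvg_sub_le (h9 : 1 / 9 < lam) (h1 : lam < 1) {k : ℤ} {c : Fin d → ℤ}
    (hu : IsPotentialOn (block k c) v u L) :
    ∫ x in block k c, (cellAvg k u x - ⨍ y in block k c, u y) ^ 2
      ≤ stepConst d lam * 9 ^ k * ∫ x in block k c, sqFun lam v k x := by
  have hb := isBounded_block k c
  have hV : 0 < volume.real (block k c) := by rw [volume_real_block]; positivity
  have mA := measurable_cellAvg k u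
  have bA := abs_cellAvg_le hu.abs_u_le k
  set T := stepConst d lam * 9 ^ k * ⨍ x in block k c, sqFun lam v k x with hT
  have pt : ∀ x ∈ block k c, (cellAvg k u x - ⨍ y in block k c, u y) ^ 2 ≤ T := by
    intro x hx
    have hxy : ∀ y ∈ block k c, (cellAvg k u y - cellAvg k u x) ^ 2 ≤ T := fun y hy =>
      (sq_sub_cellAvg_le h9 h1 hu hy hx).trans (le_of_eq (by rw [hT, stepConst]; ring))
    have hT0 : 0 ≤ T := (sq_nonneg _).trans (hxy x hx)
    have := abs_setAverage_le (volume_block_ne_zero k c) (volume_block_lt_top k c).ne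
      (f := fun y => cellAvg k u y - cellAvg k u x) (fun y hy => Real.abs_le_sqrt (hxy y hy))
    rw [setAverage_sub_const (volume_block_ne_zero k c) (volume_block_lt_top k c).ne
      (integrableOn_of_bdd mA bA hb), setAverage_block_cellAvg hu.measurable_u hu.abs_u_le] at this
    rw [← neg_sq, neg_sub]
    exact (Real.sqrt_le_sqrt_iff hT0).1 (by rwa [Real.sqrt_sq_eq_abs])
  have := setIntegral_mono_on (integrableOn_sq (mA.sub_const _) (L := L + |⨍ y in block k c, u y|)
    (fun x => (abs_sub _ _).trans (add_le_add_left (bA x) _)) hb)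
    (integrableOn_const (volume_block_lt_top k c).ne (C := T)) (measurableSet_block k c) pt
  refine this.trans (le_of_eq ?_)
  rw [setIntegral_const, smul_eq_mul, hT, setAverage_eq, smul_eq_mul]
  field_simp

lemma setIntegral_cellAvg_sub_succ_le (h9 : 1 / 9 < lam) (h1 : lam < 1) {k : ℤ}
    {S : Set (Fin d → ℝ)} (hS : IsGridSet (k + 1) S) (hb : Bornology.IsBounded S)
    (hu : IsPotentialOn S v u L) :
    ∫ x in S, (cellAvg k u x - cellAvg (k + 1) u x) ^ 2
      ≤ stepConst d lam * 9 ^ k * ∫ x in S, sqFun lam v k x := by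
  have h0 : 0 ≤ lam := by linarith
  rw [← integral_const_mul]
  refine setIntegral_le_of_cell hS hb
    (integrableOn_sq ((measurable_cellAvg k u).sub (measurable_cellAvg (k + 1) u)) (L := L + L)
      (fun x => (abs_sub _ _).trans (add_le_add (abs_cellAvg_le hu.abs_u_le k x)
        (abs_cellAvg_le hu.abs_u_le (k + 1) x))) hb)
    ((integrableOn_sqFun h0 h1 hu.abs_v_le k hb).const_mul _) fun m hm => ?_
  rw [integral_const_mul, setIntegral_congr_fun (measurableSet_cell (k + 1) m)
    (g := fun x => (cellAvg k u x - ⨍ y in cell (k + 1) m, u y) ^ 2)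
    (fun x hx => by simp only [cellAvg_eq hx])]
  rw [cell_succ] at hm ⊢
  exact setIntegral_block_cellAvg_sub_le h9 h1 (hu.mono hm)

lemma pow_mul_setIntegral_sqFun_sub_le (h9 : 1 / 9 < lam) (h1 : lam < 1)
    (hL : ∀ l x, |v l x| ≤ L) (k : ℤ) (s : ℕ) {S : Set (Fin d → ℝ)} (hb : Bornology.IsBounded S) :
    (9 : ℝ) ^ (k - s) * ∫ x in S, sqFun lam v (k - s) x
      ≤ ((9 * lam)⁻¹) ^ s * (9 ^ k * ∫ x in S, sqFun lam v k x) := by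
  have h0 : 0 < lam := by linarith
  have h := integral_mono ((integrableOn_sqFun h0.le h1 hL (k - s) hb).const_mul (lam ^ s))
    (integrableOn_sqFun h0.le h1 hL k hb) (pow_mul_sqFun_sub_le h0.le h1 hL k s)
  rw [integral_const_mul] at h
  rw [zpow_sub₀ (by norm_num), zpow_natCast, inv_pow, mul_pow]
  have h9s : (0 : ℝ) < 9 ^ s := by positivity
  have h9k : (0 : ℝ) < 9 ^ k := by positivity
  have hls : 0 < lam ^ s := by positivity
  rw [div_mul_eq_mul_div, div_le_iff₀ h9s, mul_inv, show (9 ^ s : ℝ)⁻¹ * (lam ^ s)⁻¹ *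
    (9 ^ k * ∫ x in S, sqFun lam v k x) * 9 ^ s = 9 ^ k * ((lam ^ s)⁻¹ * ∫ x in S, sqFun lam v k x)
    by field_simp]
  refine mul_le_mul_of_nonneg_left ?_ h9k.le
  rwa [le_inv_mul_iff₀ hls]

lemma setIntegral_sq_sub_cellAvg_le (h9 : 1 / 9 < lam) (h1 : lam < 1) {k : ℤ}
    {S : Set (Fin d → ℝ)} (hS : IsGridSet k S) (hb : Bornology.IsBounded S)
    (hu : IsPotentialOn S v u L) :
    ∫ x in S, (u x - cellAvg k u x) ^ 2
      ≤ stepConst d lam * ((1 - (9 * lam)⁻¹)⁻¹ - 1) * 9 ^ k * ∫ x in S, sqFun lam v k x := by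
  set q := (9 * lam)⁻¹
  have hq1 : 0 < 1 - q := one_sub_inv_pos h9
  have hq0 : 0 ≤ q := inv_nonneg.2 (by linarith)
  set I := (9 : ℝ) ^ k * ∫ x in S, sqFun lam v k x with hI
  have hI0 : 0 ≤ I := mul_nonneg (by positivity) (setIntegral_sqFun_nonneg (by linarith) _ _)
  have hK := stepConst_nonneg (d := d) h9
  set E : ℕ → ℝ := fun N => ∫ x in S, (u x - cellAvg (k - N) u x) ^ 2 with hE
  have step : ∀ N, E N ≤ E (N + 1) + stepConst d lam * (q ^ (N + 1) * I) := by
    intro N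
    have hS' : IsGridSet (k - (N + 1 : ℕ)) S := hS.of_le (by omega)
    have e : k - (N : ℤ) = k - (N + 1 : ℕ) + 1 := by push_cast; ring
    have py := setIntegral_sq_sub_eq_add hS' hb hu.measurable_u hu.abs_u_le
      (measurable_cellAvg (k - N) u) (abs_cellAvg_le hu.abs_u_le (k - N)) (fun x y h => by
        rw [cellAvg, cellAvg, idx_eq_of_le (by omega) h])
    simp only [hE]
    rw [py]
    refine add_le_add_right ?_ _
    have h2 := setIntegral_cellAvg_sub_succ_le h9 h1 (k := k - (N + 1 : ℕ)) (S := S)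
      (hS.of_le (by omega)) hb hu
    rw [← e] at h2
    refine h2.trans ?_
    rw [mul_assoc]
    exact mul_le_mul_of_nonneg_left
      (pow_mul_setIntegral_sqFun_sub_le h9 h1 hu.abs_v_le k (N + 1) hb) hK
  have bound : ∀ N, E 0 ≤ E N + stepConst d lam * (((1 - q)⁻¹ - 1) * I) := by
    have tele : ∀ N, E 0 ≤ E N
        + stepConst d lam * ((∑ i ∈ Finset.range (N + 1), q ^ i - 1) * I) := by
      intro N
      induction N with
      | zero => simp
      | succ N ih =>
        have := step N
        rw [Finset.sum_range_succ]
        linarith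
    intro N
    refine (tele N).trans (add_le_add_right (mul_le_mul_of_nonneg_left
      (mul_le_mul_of_nonneg_right (sub_le_sub_right ?_ 1) hI0) hK) _)
    rw [← tsum_geometric_of_lt_one hq0 (by linarith)]
    exact (summable_geometric_of_lt_one hq0 (by linarith)).sum_le_tsum _ fun i _ => by positivity
  have lim : Filter.Tendsto E Filter.atTop (nhds 0) := by
    have := tendsto_setIntegral_of_bdd hS.measurableSet hb
      (F := fun N : ℕ => fun x => (u x - cellAvg (k - N) u x) ^ 2) (f := fun _ => 0)
      (B := (L + L) ^ 2) (fun N => (hu.measurable_u.sub (measurable_cellAvg _ u)).pow_const 2)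
      (fun N x => by
        rw [abs_pow]
        exact pow_le_pow_left₀ (abs_nonneg _) ((abs_sub _ _).trans (add_le_add (hu.abs_u_le x)
          (abs_cellAvg_le hu.abs_u_le _ x))) 2)
      (fun x hx => by
        have := ((tendsto_cellAvg hS hu.measurable_u hu.abs_u_le hu.continuousOn_u hx).const_sub
          (u x)).pow 2
        simpa using this)
    simpa using this
  have fin := le_of_tendsto_of_tendsto' tendsto_const_nhds (lim.add_const _) bound
  rw [zero_add] at fin
  have e0 : E 0 = ∫ x in S, (u x - cellAvg k u x) ^ 2 := by simp [hE]
  rw [← e0]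
  refine fin.trans (le_of_eq ?_)
  rw [hI]; ring

/-- The constant in the multiscale Poincaré inequality. -/
def poincareConst (d : ℕ) (lam : ℝ) : ℝ := stepConst d lam * (1 - (9 * lam)⁻¹)⁻¹

lemma poincareConst_nonneg (h9 : 1 / 9 < lam) : 0 ≤ poincareConst d lam :=
  mul_nonneg (stepConst_nonneg h9) (inv_nonneg.2 (one_sub_inv_pos h9).le)

/-- Multiscale Poincaré inequality. -/
lemma setIntegral_sq_sub_setAverage_le (h9 : 1 / 9 < lam) (h1 : lam < 1) {k : ℤ} {c : Fin d → ℤ}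
    (hu : IsPotentialOn (block k c) v u L) :
    ∫ x in block k c, (u x - ⨍ y in block k c, u y) ^ 2
      ≤ poincareConst d lam * 9 ^ k * ∫ x in block k c, sqFun lam v k x := by
  rw [setIntegral_sq_sub_eq_add (isGridSet_block k c) (isBounded_block k c) hu.measurable_u
    hu.abs_u_le measurable_const (fun _ => le_rfl) (fun _ _ _ => rfl)]
  refine (add_le_add (setIntegral_sq_sub_cellAvg_le h9 h1 (isGridSet_block k c)
    (isBounded_block k c) hu) (setIntegral_block_cellAvg_sub_le h9 h1 hu)).trans (le_of_eq ?_)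
  rw [poincareConst]; ring

end Poincare

/-! ### The lattice of subcubes -/

/-- The number of grid cells of side `3 ^ (n - p)` on each side of the central one in `Q_n`. -/
def rad : ℕ → ℤ
  | 0 => 0
  | p + 1 => 3 * rad p + 1

lemma two_mul_rad (p : ℕ) : 2 * rad p + 1 = 3 ^ p := by
  induction p with
  | zero => rfl
  | succ p ih => rw [rad, pow_succ]; linarith

lemma rad_nonneg (p : ℕ) : 0 ≤ rad p := by
  have h := two_mul_rad p
  have : (1 : ℤ) ≤ 3 ^ p := one_le_pow₀ (by norm_num)
  omega

/-- The set of multi-indices bounded by `R`. -/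
def boxIdx (d : ℕ) (R : ℤ) : Finset (Fin d → ℤ) := Fintype.piFinset fun _ => Finset.Icc (-R) R

lemma mem_boxIdx {R : ℤ} {m : Fin d → ℤ} : m ∈ boxIdx d R ↔ ∀ i, |m i| ≤ R := by
  simp [boxIdx, abs_le]

lemma card_boxIdx {R : ℤ} (hR : 0 ≤ R) : ((boxIdx d R).card : ℝ) = (2 * R + 1) ^ d := by
  rw [boxIdx, Fintype.card_piFinset, Finset.prod_const, Finset.card_univ, Fintype.card_fin,
    Int.card_Icc]
  push_cast
  congr 1
  have : (((R + 1 - -R).toNat : ℤ) : ℝ) = ((R + 1 - -R : ℤ) : ℝ) := by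
    rw [Int.toNat_of_nonneg (by omega)]
  rw [Int.cast_natCast] at this
  rw [this]; push_cast; ring

lemma zpow_eq_zpow_sub_mul (n : ℤ) (p : ℕ) : (3 : ℝ) ^ n = 3 ^ (n - p) * (2 * rad p + 1) := by
  have h : (2 * rad p + 1 : ℝ) = 3 ^ p := by exact_mod_cast two_mul_rad p
  rw [h, ← zpow_natCast, ← zpow_add₀ (by norm_num)]
  congr 1; ring

lemma mem_cell_zero_iff (n : ℤ) (p : ℕ) (x : Fin d → ℝ) :
    x ∈ cell n 0 ↔ ∀ i, |idx (n - p) x i| ≤ rad p := by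
  have h3 : (0 : ℝ) < 3 ^ (n - p) := by positivity
  change idx n x = 0 ↔ _
  rw [funext_iff]
  refine forall_congr' fun i => ?_
  rw [Pi.zero_apply, idx_eq_iff, zpow_eq_zpow_sub_mul n p]
  obtain ⟨h1, h2⟩ := (idx_eq_iff (n - p) x i _).1 rfl
  rw [abs_le]
  constructor
  · rintro ⟨g1, g2⟩
    constructor
    · rw [← Int.lt_add_one_iff]
      have : (-rad p : ℝ) < idx (n - p) x i + 1 := by
        by_contra hn; push Not at hn; push_cast at g1; nlinarith
      exact_mod_cast this
    · rw [← Int.lt_add_one_iff]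
      have : (idx (n - p) x i : ℝ) < rad p + 1 := by
        by_contra hn; push Not at hn; push_cast at g2; nlinarith
      exact_mod_cast this
  · rintro ⟨g1, g2⟩
    have g1' : (-rad p : ℝ) ≤ idx (n - p) x i := by exact_mod_cast g1
    have g2' : (idx (n - p) x i : ℝ) ≤ rad p := by exact_mod_cast g2
    push_cast
    constructor <;> nlinarith

lemma cell_zero_eq_biUnion (n : ℤ) (p : ℕ) :
    (cell n 0 : Set (Fin d → ℝ)) = ⋃ m ∈ boxIdx d (rad p), cell (n - p) m := by
  ext x
  rw [mem_cell_zero_iff n p]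
  simp only [Set.mem_iUnion, mem_boxIdx]
  exact ⟨fun h => ⟨idx (n - p) x, h, rfl⟩, fun ⟨m, hm, hx⟩ => by
    rw [show idx (n - p) x = m from hx]; exact hm⟩

lemma Qc_eq_cube (d : ℕ) (n : ℤ) : Qc d n = cube d n 0 := by
  simp [Qc, cube]

lemma Qc_ae_eq_cell (n : ℤ) : Qc d n =ᵐ[volume] cell n 0 := by
  have h : (fun i => 3 ^ n * (((0 : Fin d → ℤ) i : ℤ) : ℝ)) = (0 : Fin d → ℝ) := by
    funext i; simp
  rw [Qc_eq_cube, cell_eq_hbox, h]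
  exact cube_ae_eq_hbox n 0

/-- The lattice point of `3 ^ j ℤ ^ d` with index `m`. -/
def latPt (j : ℤ) (m : Fin d → ℤ) : Fin d → ℝ := fun i => 3 ^ j * (m i : ℝ)

lemma latPt_injective (j : ℤ) : Function.Injective (latPt (d := d) j) := fun m m' h => by
  funext i
  have h3 : (3 : ℝ) ^ j ≠ 0 := by positivity
  have := mul_left_cancel₀ h3 (congrFun h i)
  exact_mod_cast this

lemma cube_ae_eq_block (k : ℤ) (m : Fin d → ℤ) :
    cube d k (latPt (k - 1) m) =ᵐ[volume] block (k - 1) m := by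
  rw [block_eq_hbox, sub_add_cancel]
  exact cube_ae_eq_hbox k _

lemma cube_subset_Qc_iff (n : ℤ) (p : ℕ) (m : Fin d → ℤ) :
    cube d (n - p) (latPt (n - p - 1) m) ⊆ Qc d n ↔ m ∈ boxIdx d (3 * rad p) := by
  rw [mem_boxIdx]
  have h3 : (0 : ℝ) < 3 ^ (n - p - 1) := by positivity
  have hk : (3 : ℝ) ^ (n - p) = 3 ^ (n - p - 1) * 3 := by
    rw [← zpow_add_one₀ (by norm_num), sub_add_cancel]
  have hn : (3 : ℝ) ^ n = 3 ^ (n - p - 1) * (6 * rad p + 3) := by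
    rw [zpow_eq_zpow_sub_mul n p, hk]; ring
  constructor
  · intro h i
    have key : ∀ s : ℝ, |s| < 3 / 2 → |(m i : ℝ) + s| < 3 * rad p + 3 / 2 := fun s hs => by
      have := h (show (latPt (n - p - 1) m + fun _ => 3 ^ (n - p - 1) * s : Fin d → ℝ) ∈ _ from
        fun l => by
          rw [Pi.add_apply, add_sub_cancel_left, abs_mul, abs_of_pos h3, hk]
          nlinarith) i
      rw [Pi.add_apply, latPt, ← mul_add, abs_mul, abs_of_pos h3, hn, mul_div_assoc,
        mul_lt_mul_iff_right₀ h3] at this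
      linarith
    have k1 := (abs_lt.1 (key 1 (by norm_num))).2
    have k2 := (abs_lt.1 (key (-1) (by norm_num))).1
    rw [abs_le, ← Int.lt_add_one_iff, ← Int.lt_add_one_iff (b := 3 * rad p)]
    constructor
    · have : (-(3 * rad p) : ℝ) < m i + 1 := by linarith
      exact_mod_cast this
    · have : (m i : ℝ) < 3 * rad p + 1 := by linarith
      exact_mod_cast this
  · intro h x hx i
    have hi : |(m i : ℝ)| ≤ 3 * rad p := by exact_mod_cast h i
    have hxi : |x i - 3 ^ (n - p - 1) * (m i : ℝ)| < 3 ^ (n - p) / 2 := hx i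
    rw [abs_le] at hi
    rw [abs_lt] at hxi ⊢
    rw [hk] at hxi
    rw [hn]
    constructor <;> nlinarith [hi.1, hi.2, hxi.1, hxi.2]

lemma subLatt_eq_image (d : ℕ) (n : ℤ) (p : ℕ) :
    subLatt d (n - p) n = latPt (n - p - 1) '' (boxIdx d (3 * rad p) : Set (Fin d → ℤ)) := by
  ext z
  constructor
  · rintro ⟨⟨m, rfl⟩, h⟩
    exact ⟨m, (cube_subset_Qc_iff n p m).1 h, rfl⟩
  · rintro ⟨m, hm, rfl⟩
    exact ⟨⟨m, rfl⟩, (cube_subset_Qc_iff n p m).2 hm⟩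

lemma avgSet_subLatt (n : ℤ) (p : ℕ) (f : (Fin d → ℝ) → ℝ) :
    avgSet (subLatt d (n - p) n) f = ((6 * rad p + 1 : ℝ) ^ d)⁻¹ *
      ∑ m ∈ boxIdx d (3 * rad p), f (latPt (n - p - 1) m) := by
  have hr := rad_nonneg p
  rw [avgSet, subLatt_eq_image, Set.ncard_image_of_injective _ (latPt_injective _),
    Set.ncard_coe_finset, card_boxIdx (by omega),
    finsum_mem_image (latPt_injective _).injOn, finsum_mem_coe_finset]
  push_cast
  ring

lemma pow_le_six_rad (p : ℕ) : ((3 : ℝ) ^ p) ≤ 6 * rad p + 1 := by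
  have h : (2 * rad p + 1 : ℝ) = 3 ^ p := by exact_mod_cast two_mul_rad p
  have h0 : (0 : ℝ) ≤ rad p := by exact_mod_cast rad_nonneg p
  linarith

lemma six_rad_le_pow (p : ℕ) : (6 * rad p + 1 : ℝ) ≤ 3 ^ p * 3 := by
  have h : (2 * rad p + 1 : ℝ) = 3 ^ p := by exact_mod_cast two_mul_rad p
  linarith

lemma block_subset_cell_zero {n : ℤ} {p : ℕ} {m : Fin d → ℤ} (hm : m ∈ boxIdx d (3 * rad p)) :
    block (n - p - 1) m ⊆ cell n 0 := fun x hx => by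
  rw [mem_cell_zero_iff n (p + 1)]
  intro i
  have h1 := hx i
  have h2 := mem_boxIdx.1 hm i
  rw [show n - ((p + 1 : ℕ) : ℤ) = n - p - 1 by push_cast; ring, rad]
  rw [abs_le] at *
  omega

/-- Averaging over overlapping subcubes is controlled by the average over the whole cube. -/
lemma sum_setAverage_block_le (n : ℤ) (p : ℕ) {G : (Fin d → ℝ) → ℝ} (hG : Measurable G) {B : ℝ}
    (hB : ∀ x, |G x| ≤ B) (h0 : ∀ x, 0 ≤ G x) :
    ((6 * rad p + 1 : ℝ) ^ d)⁻¹ * ∑ m ∈ boxIdx d (3 * rad p), ⨍ x in block (n - p - 1) m, G x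
      ≤ 3 ^ d * ⨍ x in cell n 0, G x := by
  have key : ∑ m ∈ boxIdx d (3 * rad p), ∫ x in block (n - p - 1) m, G x
      ≤ 3 ^ d * ∫ x in cell n 0, G x := by
    simp_rw [← integral_indicator (measurableSet_block _ _)]
    rw [← integral_indicator (measurableSet_cell _ _), ← integral_finsetSum _ fun m _ =>
      (integrable_indicator_iff (measurableSet_block _ _)).2
        (integrableOn_of_bdd hG hB (isBounded_block _ _)), ← integral_const_mul]
    refine integral_mono (integrable_finsetSum _ fun m _ =>
      (integrable_indicator_iff (measurableSet_block _ _)).2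
        (integrableOn_of_bdd hG hB (isBounded_block _ _)))
      (((integrable_indicator_iff (measurableSet_cell _ _)).2
        (integrableOn_of_bdd hG hB (isBounded_cell _ _))).const_mul _) fun x => ?_
    simp only
    by_cases hx : x ∈ cell n 0
    · rw [Set.indicator_of_mem hx]
      classical
      set T : Finset (Fin d → ℤ) := Fintype.piFinset fun i =>
        Finset.Icc (idx (n - p - 1) x i - 1) (idx (n - p - 1) x i + 1)
      have hT : T.card = 3 ^ d := by
        have h3 : ∀ a : ℤ, (Finset.Icc (a - 1) (a + 1)).card = 3 := fun a => by
          rw [Int.card_Icc]; omega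
        simp only [T, Fintype.card_piFinset, h3, Finset.prod_const, Finset.card_univ,
          Fintype.card_fin]
      calc ∑ m ∈ boxIdx d (3 * rad p), (block (n - p - 1) m).indicator G x
          = ∑ m ∈ boxIdx d (3 * rad p) with x ∈ block (n - p - 1) m, G x := by
            rw [Finset.sum_filter]
            refine Finset.sum_congr rfl fun m _ => ?_
            rw [Set.indicator_apply]
        _ ≤ ∑ m ∈ T, G x := by
            refine Finset.sum_le_sum_of_subset_of_nonneg (fun m hm => ?_) fun _ _ _ => h0 x
            rw [Fintype.mem_piFinset]
            intro i
            have := (Finset.mem_filter.1 hm).2 i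
            rw [Finset.mem_Icc]
            rw [abs_le] at this
            omega
        _ = 3 ^ d * G x := by
            rw [Finset.sum_const, hT, nsmul_eq_mul]; push_cast; rfl
    · rw [Set.indicator_of_notMem hx, mul_zero]
      refine (Finset.sum_eq_zero fun m hm => ?_).le
      exact Set.indicator_of_notMem (fun h => hx (block_subset_cell_zero hm h)) G
  simp_rw [setAverage_eq, smul_eq_mul, volume_real_block, volume_real_cell, sub_add_cancel]
  rw [← Finset.mul_sum]
  have hI : 0 ≤ ∫ x in cell n 0, G x := integral_nonneg h0
  have hn : ((3 : ℝ) ^ n) ^ d = (3 ^ p) ^ d * (3 ^ (n - p)) ^ d := by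
    rw [← mul_pow, ← zpow_natCast 3 p, ← zpow_add₀ (by norm_num)]
    congr 2; ring
  have hle : ((6 * rad p + 1 : ℝ) ^ d)⁻¹ ≤ ((3 ^ p) ^ d)⁻¹ :=
    inv_anti₀ (by positivity) (pow_le_pow_left₀ (by positivity) (pow_le_six_rad p) d)
  calc ((6 * rad p + 1 : ℝ) ^ d)⁻¹ * (((3 ^ (n - p)) ^ d)⁻¹ *
        ∑ m ∈ boxIdx d (3 * rad p), ∫ x in block (n - p - 1) m, G x)
      ≤ ((3 ^ p) ^ d)⁻¹ * (((3 ^ (n - p)) ^ d)⁻¹ * (3 ^ d * ∫ x in cell n 0, G x)) := by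
        gcongr
        exact mul_nonneg (by positivity)
          (Finset.sum_nonneg fun m _ => integral_nonneg h0)
    _ = 3 ^ d * (((3 ^ n) ^ d)⁻¹ * ∫ x in cell n 0, G x) := by
        rw [hn, mul_inv]; ring

/-- The mean over the cells of a partition is controlled by the mean over all subcubes. -/
lemma setAverage_sum_cellAvg_sq_le (n : ℤ) (p : ℕ) {v : Fin d → (Fin d → ℝ) → ℝ} {L : ℝ}
    (hL : ∀ l x, |v l x| ≤ L) :
    ⨍ x in cell n 0, ∑ l, cellAvg (n - p) (v l) x ^ 2
      ≤ 3 ^ d * (((6 * rad p + 1 : ℝ) ^ d)⁻¹ *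
        ∑ m ∈ boxIdx d (3 * rad p), ∑ l, (⨍ x in block (n - p - 1) m, v l x) ^ 2) := by
  set f : (Fin d → ℤ) → ℝ := fun m => ∑ l, (⨍ x in block (n - p - 1) m, v l x) ^ 2
  have hf0 : ∀ m, 0 ≤ f m := fun m => Finset.sum_nonneg fun _ _ => sq_nonneg _
  have hm : Measurable fun x => ∑ l, cellAvg (n - p) (v l) x ^ 2 :=
    Finset.measurable_fun_sum _ fun l _ => (measurable_cellAvg _ _).pow_const 2
  have key : ∫ x in cell n 0, ∑ l, cellAvg (n - p) (v l) x ^ 2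
      = (3 ^ (n - p)) ^ d * ∑ m ∈ boxIdx d (rad p), f (fun i => 3 * m i) := by
    rw [setIntegral_eq_sum (cell_zero_eq_biUnion n p) (integrableOn_of_bdd hm
      (L := d * L ^ 2) (fun x => by
        rw [abs_of_nonneg (sum_cellAvg_sq_nonneg v _ x)]
        exact sum_cellAvg_sq_le hL _ x) (isBounded_cell _ _)), Finset.mul_sum]
    refine Finset.sum_congr rfl fun m _ => ?_
    rw [setIntegral_congr_fun (measurableSet_cell _ m) (g := fun _ => f fun i => 3 * m i)
      (fun x hx => ?_), setIntegral_const, volume_real_cell, smul_eq_mul]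
    have hc : cell (n - p) m = block (n - p - 1) fun i => 3 * m i := by
      rw [← cell_succ, sub_add_cancel]
    simp only [f, cellAvg_eq hx, hc]
  have hsub : ∑ m ∈ boxIdx d (rad p), f (fun i => 3 * m i) ≤ ∑ m ∈ boxIdx d (3 * rad p), f m := by
    classical
    rw [← Finset.sum_image (f := f) (g := fun (m : Fin d → ℤ) i => 3 * m i)
      (s := boxIdx d (rad p)) (fun m _ m' _ h => by
        funext i; have := congrFun h i; simp only at this; omega)]
    refine Finset.sum_le_sum_of_subset_of_nonneg (fun m hm => ?_) fun m _ _ => hf0 m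
    obtain ⟨m', hm', rfl⟩ := Finset.mem_image.1 hm
    refine mem_boxIdx.2 fun i => ?_
    have := mem_boxIdx.1 hm' i
    rw [abs_le] at *
    omega
  rw [setAverage_eq, smul_eq_mul, volume_real_cell, key]
  have hn : ((3 : ℝ) ^ n) ^ d = (3 ^ p) ^ d * (3 ^ (n - p)) ^ d := by
    rw [← mul_pow, ← zpow_natCast 3 p, ← zpow_add₀ (by norm_num)]
    congr 2; ring
  have h6 : (0 : ℝ) < 6 * rad p + 1 := lt_of_lt_of_le (by positivity) (pow_le_six_rad p)
  have hle : ((3 ^ p * 3 : ℝ) ^ d)⁻¹ ≤ ((6 * rad p + 1 : ℝ) ^ d)⁻¹ :=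
    inv_anti₀ (by positivity) (pow_le_pow_left₀ h6.le (six_rad_le_pow p) d)
  have hk : ((3 : ℝ) ^ (n - p)) ^ d ≠ 0 := by positivity
  calc (((3 : ℝ) ^ n) ^ d)⁻¹ * ((3 ^ (n - p)) ^ d * ∑ m ∈ boxIdx d (rad p), f (fun i => 3 * m i))
      = 3 ^ d * (((3 ^ p * 3 : ℝ) ^ d)⁻¹ * ∑ m ∈ boxIdx d (rad p), f (fun i => 3 * m i)) := by
        rw [hn, mul_pow]; field_simp
    _ ≤ _ := by
        gcongr

/-! ### Summation over the scales -/

section Scales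

variable {lam L : ℝ} {v : Fin d → (Fin d → ℝ) → ℝ} {u : (Fin d → ℝ) → ℝ}

lemma setAverage_block_sq_sub_le (h9 : 1 / 9 < lam) (h1 : lam < 1) {k : ℤ} {c : Fin d → ℤ}
    (hu : IsPotentialOn (block (k - 1) c) v u L) :
    ⨍ x in block (k - 1) c, (u x - ⨍ y in block (k - 1) c, u y) ^ 2
      ≤ poincareConst d lam * 9 ^ k * ⨍ x in block (k - 1) c, sqFun lam v k x := by
  have h := setIntegral_sq_sub_setAverage_le h9 h1 hu
  have h2 := pow_mul_setIntegral_sqFun_sub_le h9 h1 hu.abs_v_le k 1 (isBounded_block (k - 1) c)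
  have hK := poincareConst_nonneg (d := d) h9
  have hI : 0 ≤ (9 : ℝ) ^ k * ∫ x in block (k - 1) c, sqFun lam v k x :=
    mul_nonneg (by positivity) (setIntegral_sqFun_nonneg (by linarith) _ _)
  have hq := one_sub_inv_pos h9
  rw [pow_one, Nat.cast_one] at h2
  have h3 : (9 : ℝ) ^ (k - 1) * ∫ x in block (k - 1) c, sqFun lam v (k - 1) x
      ≤ 9 ^ k * ∫ x in block (k - 1) c, sqFun lam v k x :=
    h2.trans (mul_le_of_le_one_left hI (by linarith))
  rw [setAverage_eq, setAverage_eq _ (sqFun lam v k), smul_eq_mul, smul_eq_mul]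
  have hV : 0 ≤ (volume.real (block (k - 1) c))⁻¹ := by positivity
  refine (mul_le_mul_of_nonneg_left (h.trans ?_) hV).trans (le_of_eq (mul_left_comm _ _ _))
  rw [mul_assoc, mul_assoc]
  exact mul_le_mul_of_nonneg_left h3 hK

/-- The mean over `Q_n` of the squared averages of `v` at scale `n - q`. -/
def meanSq (n : ℤ) (v : Fin d → (Fin d → ℝ) → ℝ) (q : ℕ) : ℝ :=
  ⨍ x in cell n 0, ∑ l, cellAvg (n - q) (v l) x ^ 2

lemma setAverage_nonneg {f : (Fin d → ℝ) → ℝ} (hf : ∀ x, 0 ≤ f x) (S : Set (Fin d → ℝ)) :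
    0 ≤ ⨍ x in S, f x := by
  rw [setAverage_eq]
  exact smul_nonneg (by positivity) (integral_nonneg hf)

lemma meanSq_nonneg (n : ℤ) (v : Fin d → (Fin d → ℝ) → ℝ) (q : ℕ) : 0 ≤ meanSq n v q :=
  setAverage_nonneg (sum_cellAvg_sq_nonneg v _) _

lemma meanSq_le (n : ℤ) (hL : ∀ l x, |v l x| ≤ L) (q : ℕ) : meanSq n v q ≤ d * L ^ 2 :=
  (le_abs_self _).trans (abs_setAverage_le (volume_cell_ne_zero _ _) (volume_cell_lt_top _ _).ne
    fun x _ => by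
      rw [abs_of_nonneg (sum_cellAvg_sq_nonneg v _ x)]; exact sum_cellAvg_sq_le hL _ x)

lemma setAverage_sqFun (h0 : 0 ≤ lam) (h1 : lam < 1) (hL : ∀ l x, |v l x| ≤ L) (n : ℤ) (p : ℕ) :
    ⨍ x in cell n 0, sqFun lam v (n - p) x = ∑' i, lam ^ i * meanSq n v (p + i) := by
  have hi : ∀ i : ℕ, n - p - (i : ℤ) = n - ((p + i : ℕ) : ℤ) := fun i => by push_cast; ring
  have hm : ∀ i : ℕ, Measurable fun x =>
      lam ^ i * ∑ l, cellAvg (n - ((p + i : ℕ) : ℤ)) (v l) x ^ 2 := fun i =>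
    (Finset.measurable_fun_sum _ fun l _ => (measurable_cellAvg _ _).pow_const 2).const_mul _
  have hnn : ∀ (i : ℕ) x, 0 ≤ lam ^ i * ∑ l, cellAvg (n - ((p + i : ℕ) : ℤ)) (v l) x ^ 2 :=
    fun i x => mul_nonneg (pow_nonneg h0 i) (sum_cellAvg_sq_nonneg v _ x)
  have hV : volume.real (cell n (0 : Fin d → ℤ)) ≠ 0 := by
    rw [volume_real_cell]; positivity
  have e : ∀ i : ℕ, ∫ x in cell n 0, lam ^ i * ∑ l, cellAvg (n - ((p + i : ℕ) : ℤ)) (v l) x ^ 2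
      = volume.real (cell n (0 : Fin d → ℤ)) * (lam ^ i * meanSq n v (p + i)) := fun i => by
    rw [integral_const_mul, meanSq, setAverage_eq, smul_eq_mul]; field_simp
  have hsum : Summable fun i => lam ^ i * meanSq n v (p + i) :=
    summable_geometric_mul h0 h1 (fun i => meanSq_nonneg n v _) fun i => meanSq_le n hL _
  have := integral_tsum_of_summable_integral_norm (μ := volume.restrict (cell n 0))
    (F := fun (i : ℕ) x => lam ^ i * ∑ l, cellAvg (n - ((p + i : ℕ) : ℤ)) (v l) x ^ 2)
    (fun i => integrableOn_of_bdd (hm i) (L := lam ^ i * (d * L ^ 2)) (fun x => by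
      rw [abs_of_nonneg (hnn i x)]
      exact mul_le_mul_of_nonneg_left (sum_cellAvg_sq_le hL _ x) (pow_nonneg h0 i))
      (isBounded_cell _ _))
    (by
      simp_rw [fun i x => Real.norm_of_nonneg (hnn i x), e]
      exact hsum.mul_left _)
  simp_rw [e] at this
  rw [tsum_mul_left] at this
  rw [setAverage_eq, smul_eq_mul]
  simp only [sqFun, hi]
  rw [← this]
  field_simp

lemma sum_tsum_pow_mul_le {a : ℝ} (h0 : 0 ≤ a) (h1 : a < 1) {y : ℕ → ℝ} (hy : ∀ q, 0 ≤ y q)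
    (hs : Summable y) (P : ℕ) :
    ∑ p ∈ Finset.range P, ∑' i, a ^ i * y (p + i) ≤ (1 - a)⁻¹ * ∑' q, y q := by
  have hle : ∀ q, y q ≤ ∑' q, y q := fun q => hs.le_tsum q fun j _ => hy j
  have hsum : ∀ p, Summable fun i => a ^ i * y (p + i) := fun p =>
    summable_geometric_mul h0 h1 (fun i => hy _) fun i => hle _
  rw [← Summable.tsum_finsetSum fun p _ => hsum p, ← tsum_geometric_of_lt_one h0 h1,
    ← tsum_mul_right]
  refine Summable.tsum_le_tsum (fun i => ?_) (summable_sum fun p _ => hsum p)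
    ((summable_geometric_of_lt_one h0 h1).mul_right _)
  rw [← Finset.mul_sum]
  refine mul_le_mul_of_nonneg_left ?_ (pow_nonneg h0 i)
  calc ∑ p ∈ Finset.range P, y (p + i)
      ≤ ∑' p, y (p + i) := ((summable_nat_add_iff i).2 hs).sum_le_tsum _ fun p _ => hy _
    _ ≤ ∑' q, y q := by
        rw [← hs.sum_add_tsum_nat_add i]
        exact le_add_of_nonneg_left (Finset.sum_nonneg fun q _ => hy q)

variable {a : ℝ}

/-- The weighted sum over the scales of the mean squares of the averages of `v`. -/
def scaleSum (n : ℤ) (v : Fin d → (Fin d → ℝ) → ℝ) (a : ℝ) : ℝ :=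
  ∑' q, ((9 * a ^ 2)⁻¹) ^ q * meanSq n v q

lemma inv_sq_lt_one (ha : 1 / 3 < a) : (9 * a ^ 2)⁻¹ < 1 :=
  inv_lt_one_of_one_lt₀ (by nlinarith)

lemma one_ninth_lt_inv (ha : 1 / 3 < a) (ha1 : a < 1) : 1 / 9 < (9 * a)⁻¹ := by
  rw [one_div]
  exact inv_strictAnti₀ (by linarith) (by linarith)

lemma inv_lt_one_of_third (ha : 1 / 3 < a) : (9 * a)⁻¹ < 1 :=
  inv_lt_one_of_one_lt₀ (by linarith)

lemma summable_scaleSum (n : ℤ) (ha : 1 / 3 < a) (hL : ∀ l x, |v l x| ≤ L) :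
    Summable fun q => ((9 * a ^ 2)⁻¹) ^ q * meanSq n v q :=
  summable_geometric_mul (by positivity) (inv_sq_lt_one ha) (meanSq_nonneg n v) (meanSq_le n hL)

lemma scaleSum_nonneg (n : ℤ) (v : Fin d → (Fin d → ℝ) → ℝ) (a : ℝ) : 0 ≤ scaleSum n v a :=
  tsum_nonneg fun q => mul_nonneg (by positivity) (meanSq_nonneg n v q)

lemma setAverage_cell_sq_le (ha : 1 / 3 < a) (ha1 : a < 1) {n : ℤ}
    (hu : IsPotentialOn (cell n 0) v u L) (h0 : ⨍ x in cell n 0, u x = 0) :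
    ⨍ x in cell n 0, u x ^ 2 ≤ poincareConst d (9 * a)⁻¹ * 9 ^ n * scaleSum n v a := by
  have h9 := one_ninth_lt_inv ha ha1
  have hl1 := inv_lt_one_of_third ha
  have hl0 : 0 ≤ (9 * a)⁻¹ := by linarith
  have hc : cell n (0 : Fin d → ℤ) = block (n - 1) 0 := by
    have := cell_succ (n - 1) (0 : Fin d → ℤ)
    rw [sub_add_cancel] at this
    rw [this]; congr 1
  have h := setAverage_block_sq_sub_le h9 hl1 (k := n) (c := 0) (hc ▸ hu)
  rw [← hc, h0] at h
  simp only [sub_zero] at h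
  have e := setAverage_sqFun hl0 hl1 hu.abs_v_le n 0
  rw [Nat.cast_zero, sub_zero] at e
  rw [e] at h
  refine h.trans (mul_le_mul_of_nonneg_left ?_
    (mul_nonneg (poincareConst_nonneg h9) (by positivity)))
  refine Summable.tsum_le_tsum (fun i => ?_) (summable_geometric_mul hl0 hl1
    (fun i => meanSq_nonneg n v _) fun i => meanSq_le n hu.abs_v_le _)
    (summable_scaleSum n ha hu.abs_v_le)
  rw [zero_add]
  refine mul_le_mul_of_nonneg_right (pow_le_pow_left₀ hl0 ?_ i) (meanSq_nonneg n v i)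
  exact inv_anti₀ (by positivity) (by nlinarith)

lemma sum_setAverage_sq_sub_le (ha : 1 / 3 < a) (ha1 : a < 1) {n : ℤ}
    (hu : IsPotentialOn (cell n 0) v u L) (P : ℕ) :
    ∑ p ∈ Finset.range P, ((a ^ 2)⁻¹) ^ p * (((6 * rad p + 1 : ℝ) ^ d)⁻¹ *
        ∑ m ∈ boxIdx d (3 * rad p), ⨍ x in block (n - p - 1) m,
          (u x - ⨍ y in block (n - p - 1) m, u y) ^ 2)
      ≤ poincareConst d (9 * a)⁻¹ * 3 ^ d * 9 ^ n * ((1 - a)⁻¹ * scaleSum n v a) := by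
  have h9 := one_ninth_lt_inv ha ha1
  have hl1 := inv_lt_one_of_third ha
  have hl0 : 0 ≤ (9 * a)⁻¹ := by linarith
  have ha0 : 0 < a := by linarith
  have hK := poincareConst_nonneg (d := d) h9
  refine le_trans (Finset.sum_le_sum fun p _ => ?_) (le_trans (le_of_eq (Finset.mul_sum
    (Finset.range P) (fun p => ∑' i, a ^ i * (((9 * a ^ 2)⁻¹) ^ (p + i) * meanSq n v (p + i)))
    (poincareConst d (9 * a)⁻¹ * 3 ^ d * 9 ^ n)).symm)
    (mul_le_mul_of_nonneg_left (sum_tsum_pow_mul_le ha0.le ha1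
      (fun q => mul_nonneg (by positivity) (meanSq_nonneg n v q))
      (summable_scaleSum n ha hu.abs_v_le) P) (by positivity)))
  set K := poincareConst d (9 * a)⁻¹
  have hr : (0 : ℝ) < 6 * rad p + 1 := lt_of_lt_of_le (by positivity) (pow_le_six_rad p)
  have s1 : ((6 * rad p + 1 : ℝ) ^ d)⁻¹ * ∑ m ∈ boxIdx d (3 * rad p),
        ⨍ x in block (n - p - 1) m, (u x - ⨍ y in block (n - p - 1) m, u y) ^ 2
      ≤ K * 9 ^ (n - p) * (3 ^ d * ∑' i, (9 * a)⁻¹ ^ i * meanSq n v (p + i)) := by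
    rw [← setAverage_sqFun hl0 hl1 hu.abs_v_le]
    refine le_trans ?_ (mul_le_mul_of_nonneg_left (sum_setAverage_block_le n p
      (measurable_sqFun hl0 hl1 hu.abs_v_le _) (abs_sqFun_le hl0 hl1 hu.abs_v_le _)
      (sqFun_nonneg hl0 _)) (by positivity))
    rw [mul_left_comm, Finset.mul_sum _ _ (K * 9 ^ (n - (p : ℤ)))]
    refine mul_le_mul_of_nonneg_left (Finset.sum_le_sum fun m hm => ?_)
      (inv_nonneg.2 (pow_nonneg hr.le d))
    exact setAverage_block_sq_sub_le h9 hl1 (hu.mono (block_subset_cell_zero hm))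
  refine (mul_le_mul_of_nonneg_left s1 (by positivity)).trans (le_of_eq ?_)
  have e : ∀ i, a ^ i * ((9 * a ^ 2)⁻¹ ^ (p + i) * meanSq n v (p + i))
      = (9 * a ^ 2)⁻¹ ^ p * ((9 * a)⁻¹ ^ i * meanSq n v (p + i)) := fun i => by
    have : a ^ i * (9 * a ^ 2)⁻¹ ^ i = (9 * a)⁻¹ ^ i := by
      rw [← mul_pow]; congr 1; field_simp
    rw [pow_add, ← this]; ring
  simp_rw [e]
  rw [tsum_mul_left, zpow_sub₀ (by norm_num), zpow_natCast, mul_inv 9 (a ^ 2), mul_pow, inv_pow 9]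
  ring

end Scales

/-! ### Smooth functions -/

lemma Qc_eq_ball (d : ℕ) (n : ℤ) : Qc d n = Metric.ball 0 (3 ^ n / 2) := by
  have h3 : (0 : ℝ) < 3 ^ n / 2 := by positivity
  ext x
  rw [mem_ball_zero_iff, pi_norm_lt_iff h3]
  rfl

lemma closure_Qc (d : ℕ) (n : ℤ) : closure (Qc d n) = Metric.closedBall 0 (3 ^ n / 2) := by
  have h3 : (3 : ℝ) ^ n / 2 ≠ 0 := by positivity
  rw [Qc_eq_ball, closure_ball _ h3]

lemma cell_zero_subset_closure_Qc (n : ℤ) : cell n 0 ⊆ closure (Qc d n) := fun x hx => by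
  have h3 : (0 : ℝ) ≤ 3 ^ n / 2 := by positivity
  rw [closure_Qc, mem_closedBall_zero_iff, pi_norm_le_iff_of_nonneg h3]
  intro i
  obtain ⟨h1, h2⟩ := (idx_eq_iff n x i 0).1 (congrFun hx i)
  rw [Int.cast_zero, mul_zero] at h1 h2
  rw [Real.norm_eq_abs, abs_le]
  constructor <;> linarith

lemma measurable_indicator_of_continuousOn {f : (Fin d → ℝ) → ℝ} {K : Set (Fin d → ℝ)}
    (hf : ContinuousOn f K) (hK : MeasurableSet K) : Measurable (K.indicator f) := by
  classical
  rw [← Set.piecewise_eq_indicator]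
  exact hf.measurable_piecewise continuousOn_const hK

lemma abs_indicator_le {f : (Fin d → ℝ) → ℝ} {K : Set (Fin d → ℝ)} {C : ℝ}
    (h : ∀ x ∈ K, ‖f x‖ ≤ C) (x : Fin d → ℝ) : |K.indicator f x| ≤ |C| := by
  by_cases hx : x ∈ K
  · rw [Set.indicator_of_mem hx]; exact (h x hx).trans (le_abs_self C)
  · rw [Set.indicator_of_notMem hx, abs_zero]; exact abs_nonneg C

/-- A function that is `C¹` near the closed cube is a bounded potential of its gradient. -/
lemma exists_isPotentialOn {n : ℤ} {u : (Fin d → ℝ) → ℝ} {V : Set (Fin d → ℝ)} (hV : IsOpen V)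
    (hQV : closure (Qc d n) ⊆ V) (hu : ContDiffOn ℝ 1 u V) :
    ∃ L, IsPotentialOn (cell n 0)
      (fun i => (closure (Qc d n)).indicator fun x => grad d u x i)
      ((closure (Qc d n)).indicator u) L := by
  set K := closure (Qc d n) with hKdef
  have hKc : IsCompact K := by
    rw [hKdef, closure_Qc]; exact isCompact_closedBall _ _
  have hKm : MeasurableSet K := isClosed_closure.measurableSet
  have cu : ContinuousOn u K := hu.continuousOn.mono hQV
  have cv : ∀ i, ContinuousOn (fun x => grad d u x i) K := fun i =>
    ((hu.continuousOn_fderiv_of_isOpen hV le_rfl).mono hQV).clm_apply continuousOn_const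
  obtain ⟨Cu, hCu⟩ := hKc.exists_bound_of_continuousOn cu
  choose Cv hCv using fun i => hKc.exists_bound_of_continuousOn (cv i)
  have hsub := cell_zero_subset_closure_Qc (d := d) n
  refine ⟨|Cu| + ∑ i, |Cv i|, measurable_indicator_of_continuousOn cu hKm,
    fun i => measurable_indicator_of_continuousOn (cv i) hKm, fun x => ?_, fun i x => ?_, ?_,
    fun i => ?_, ?_⟩
  · exact (abs_indicator_le hCu x).trans
      (le_add_of_nonneg_right (Finset.sum_nonneg fun _ _ => abs_nonneg _))
  · refine (abs_indicator_le (hCv i) x).trans ?_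
    have := Finset.single_le_sum (fun i _ => abs_nonneg (Cv i)) (Finset.mem_univ i)
    linarith [abs_nonneg Cu]
  · exact (cu.mono hsub).congr fun x hx => Set.indicator_of_mem (hsub hx) u
  · exact ((cv i).mono hsub).congr fun x hx => Set.indicator_of_mem (hsub hx) _
  · intro x hx i s hs hxs
    have hseg : ∀ r ∈ Set.Icc 0 s, x + Pi.single i r ∈ K := by
      intro r hr
      have hx' := hsub hx
      have hxs' := hsub hxs
      have h3 : (0 : ℝ) ≤ 3 ^ n / 2 := by positivity
      rw [closure_Qc, mem_closedBall_zero_iff, pi_norm_le_iff_of_nonneg h3] at hx' hxs'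
      rw [hKdef, closure_Qc, mem_closedBall_zero_iff, pi_norm_le_iff_of_nonneg h3]
      intro l
      have h1 := hx' l
      have h2 := hxs' l
      rw [Real.norm_eq_abs, abs_le] at h1 h2 ⊢
      rcases eq_or_ne l i with rfl | hli
      · rw [Pi.add_apply, Pi.single_eq_same] at h2 ⊢
        constructor <;> linarith [h1.1, h2.2, hr.1, hr.2]
      · rw [Pi.add_apply, Pi.single_eq_of_ne hli, add_zero]
        exact h1
    have huIcc : Set.uIcc 0 s = Set.Icc 0 s := Set.uIcc_of_le hs
    rw [Set.indicator_of_mem (hsub hx), Set.indicator_of_mem (hsub hxs)]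
    have hder : ∀ r ∈ Set.uIcc 0 s, HasDerivAt (fun r => u (x + Pi.single i r))
        (grad d u (x + Pi.single i r) i) r := by
      intro r hr
      rw [huIcc] at hr
      have hd : HasFDerivAt u (fderiv ℝ u (x + Pi.single i r)) (x + Pi.single i r) :=
        ((hu.differentiableOn one_ne_zero).differentiableAt
          (hV.mem_nhds (hQV (hseg r hr)))).hasFDerivAt
      exact hd.comp_hasDerivAt r ((hasDerivAt_single i r).const_add x)
    have hcont : ContinuousOn (fun r : ℝ => x + Pi.single i r) (Set.uIcc 0 s) :=
      (continuous_const.add (continuous_single (A := fun _ : Fin d => ℝ) i)).continuousOn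
    have := intervalIntegral.integral_eq_sub_of_hasDerivAt hder
      (((cv i).comp hcont (fun r hr => hseg r (huIcc ▸ hr))).intervalIntegrable)
    rw [Pi.single_zero, add_zero] at this
    rw [← this]
    refine intervalIntegral.integral_congr fun r hr => ?_
    exact (Set.indicator_of_mem (hseg r (huIcc ▸ hr)) (fun x => grad d u x i)).symm

section Variance

variable {α ι : Type*} [MeasurableSpace α] {μ : Measure α} [IsProbabilityMeasure μ]

lemma integral_sq_sub_const {f : α → ℝ} (hf : AEStronglyMeasurable f μ) {L : ℝ}
    (hL : ∀ᵐ x ∂μ, |f x| ≤ L) (c : ℝ) :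
    ∫ x, (f x - c) ^ 2 ∂μ = ∫ x, f x ^ 2 ∂μ - 2 * c * ∫ x, f x ∂μ + c ^ 2 := by
  have i1 : Integrable f μ := Integrable.of_bound hf L hL
  have i2 : Integrable (fun x => f x ^ 2) μ := Integrable.of_bound (hf.pow 2) (L ^ 2) <| by
    filter_upwards [hL] with x hx
    rw [norm_pow]
    exact pow_le_pow_left₀ (norm_nonneg _) hx 2
  have i3 : Integrable (fun x => f x ^ 2 - 2 * c * f x) μ := i2.sub (i1.const_mul _)
  have e : ∀ x, (f x - c) ^ 2 = f x ^ 2 - 2 * c * f x + c ^ 2 := fun x => by ring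
  simp_rw [e]
  rw [integral_add i3 (integrable_const _), integral_sub i2 (i1.const_mul _), integral_const_mul,
    integral_const, probReal_univ, one_smul]

lemma sq_integral_le {f : α → ℝ} (hf : AEStronglyMeasurable f μ) {L : ℝ}
    (hL : ∀ᵐ x ∂μ, |f x| ≤ L) : (∫ x, f x ∂μ) ^ 2 ≤ ∫ x, f x ^ 2 ∂μ := by
  have h := integral_sq_sub_const hf hL (∫ x, f x ∂μ)
  have : 0 ≤ ∫ x, (f x - ∫ x, f x ∂μ) ^ 2 ∂μ := integral_nonneg fun x => sq_nonneg _
  nlinarith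

lemma integral_sq_sub_integral_le {f : α → ℝ} (hf : AEStronglyMeasurable f μ) {L : ℝ}
    (hL : ∀ᵐ x ∂μ, |f x| ≤ L) (c : ℝ) :
    ∫ x, (f x - ∫ y, f y ∂μ) ^ 2 ∂μ ≤ ∫ x, (f x - c) ^ 2 ∂μ := by
  rw [integral_sq_sub_const hf hL, integral_sq_sub_const hf hL]
  nlinarith [sq_nonneg (∫ x, f x ∂μ - c)]

lemma integrable_sq_sub {f : α → ℝ} (hf : AEStronglyMeasurable f μ) {L : ℝ}
    (hL : ∀ᵐ x ∂μ, |f x| ≤ L) (c : ℝ) : Integrable (fun x => (f x - c) ^ 2) μ := by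
  refine Integrable.of_bound ((hf.sub aestronglyMeasurable_const).pow 2) ((L + |c|) ^ 2) ?_
  filter_upwards [hL] with x hx
  rw [norm_pow]
  exact pow_le_pow_left₀ (norm_nonneg _) ((abs_sub _ _).trans (add_le_add_left hx _)) 2

/-- The variance of the product of `u` with a slowly varying bounded vector field. -/
lemma integral_sum_sq_mul_sub_le [Fintype ι] {u : α → ℝ} {g : ι → α → ℝ} {c : ι → ℝ} {L A B : ℝ}
    (hu : AEStronglyMeasurable u μ) (hL : ∀ᵐ x ∂μ, |u x| ≤ L)
    (hg : ∀ i, AEStronglyMeasurable (g i) μ) (hA : ∀ᵐ x ∂μ, ∑ i, g i x ^ 2 ≤ A) (hB0 : 0 ≤ B)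
    (hB : ∀ᵐ x ∂μ, ∑ i, (g i x - c i) ^ 2 ≤ B) :
    ∫ x, ∑ i, (u x * g i x - ∫ y, u y * g i y ∂μ) ^ 2 ∂μ
      ≤ 2 * A * ∫ x, (u x - ∫ y, u y ∂μ) ^ 2 ∂μ + 2 * B * ∫ x, u x ^ 2 ∂μ := by
  set U := ∫ y, u y ∂μ with hU
  have hm : ∀ i, AEStronglyMeasurable (fun x => u x * g i x) μ := fun i => hu.mul (hg i)
  have hb : ∀ i, ∀ᵐ x ∂μ, |u x * g i x| ≤ L * √A := fun i => by
    filter_upwards [hL, hA] with x hx hAx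
    rw [abs_mul]
    refine mul_le_mul hx (Real.abs_le_sqrt ?_) (abs_nonneg _) ((abs_nonneg _).trans hx)
    exact (Finset.single_le_sum (fun i _ => sq_nonneg (g i x)) (Finset.mem_univ i)).trans hAx
  have hUi := integrable_sq_sub hu hL U
  calc ∫ x, ∑ i, (u x * g i x - ∫ y, u y * g i y ∂μ) ^ 2 ∂μ
      = ∑ i, ∫ x, (u x * g i x - ∫ y, u y * g i y ∂μ) ^ 2 ∂μ :=
        integral_finsetSum _ fun i _ => integrable_sq_sub (hm i) (hb i) _
    _ ≤ ∑ i, ∫ x, (u x * g i x - U * c i) ^ 2 ∂μ :=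
        Finset.sum_le_sum fun i _ => integral_sq_sub_integral_le (hm i) (hb i) _
    _ = ∫ x, ∑ i, (u x * g i x - U * c i) ^ 2 ∂μ :=
        (integral_finsetSum _ fun i _ => integrable_sq_sub (hm i) (hb i) _).symm
    _ ≤ ∫ x, (2 * A * (u x - U) ^ 2 + 2 * B * U ^ 2) ∂μ := by
        refine integral_mono_ae (integrable_finsetSum _ fun i _ =>
          integrable_sq_sub (hm i) (hb i) _) ((hUi.const_mul _).add (integrable_const _)) ?_
        filter_upwards [hA, hB] with x hAx hBx
        calc ∑ i, (u x * g i x - U * c i) ^ 2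
            ≤ ∑ i, (2 * (u x - U) ^ 2 * g i x ^ 2 + 2 * U ^ 2 * (g i x - c i) ^ 2) :=
              Finset.sum_le_sum fun i _ => by
                nlinarith [sq_nonneg ((u x - U) * g i x - U * (g i x - c i))]
          _ = 2 * (u x - U) ^ 2 * ∑ i, g i x ^ 2 + 2 * U ^ 2 * ∑ i, (g i x - c i) ^ 2 := by
              rw [Finset.sum_add_distrib, Finset.mul_sum, Finset.mul_sum]
          _ ≤ 2 * (u x - U) ^ 2 * A + 2 * U ^ 2 * B := by gcongr
          _ = 2 * A * (u x - U) ^ 2 + 2 * B * U ^ 2 := by ring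
    _ = 2 * A * ∫ x, (u x - U) ^ 2 ∂μ + 2 * B * U ^ 2 := by
        rw [integral_add (hUi.const_mul _) (integrable_const _), integral_const_mul,
          integral_const, probReal_univ, one_smul]
    _ ≤ _ := by
        refine add_le_add_right (mul_le_mul_of_nonneg_left (sq_integral_le hu hL) (by positivity)) _

end Variance

/-! ### Multiplication by a cutoff -/

lemma abs_grad_sub_le {φ : (Fin d → ℝ) → ℝ} (hφ : ContDiff ℝ (⊤ : ℕ∞) φ) {n : ℤ} {M : ℝ}
    (hM : ∀ x ∈ Qc d n, ‖iteratedFDeriv ℝ 2 φ x‖ ≤ M) {x z : Fin d → ℝ} (hx : x ∈ Qc d n)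
    (hz : z ∈ Qc d n) (i : Fin d) : |grad d φ x i - grad d φ z i| ≤ M * dist x z := by
  have hconv : Convex ℝ (Qc d n) := by rw [Qc_eq_ball]; exact convex_ball _ _
  have hdiff : Differentiable ℝ (fderiv ℝ φ) :=
    (hφ.fderiv_right (m := 1) (WithTop.coe_le_coe.2 le_top)).differentiable one_ne_zero
  have h := hconv.norm_image_sub_le_of_norm_fderiv_le (f := fderiv ℝ φ) (C := M)
    (fun y _ => hdiff y) (fun y hy => by
      rw [← norm_iteratedFDeriv_one, norm_iteratedFDeriv_fderiv]; exact hM y hy) hz hx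
  have h1 := (fderiv ℝ φ x - fderiv ℝ φ z).le_opNorm (Pi.single i 1)
  rw [Pi.norm_single, norm_one, mul_one] at h1
  rw [dist_eq_norm]
  exact h1.trans h

lemma measurable_grad {φ : (Fin d → ℝ) → ℝ} (hφ : ContDiff ℝ (⊤ : ℕ∞) φ) (i : Fin d) :
    Measurable fun x => grad d φ x i :=
  ((hφ.continuous_fderiv (by simp)).clm_apply continuous_const).measurable

lemma isOpen_Qc (d : ℕ) (n : ℤ) : IsOpen (Qc d n) := by
  rw [Qc_eq_ball]; exact Metric.isOpen_ball

lemma measurableSet_cube (k : ℤ) (z : Fin d → ℝ) : MeasurableSet (cube d k z) := by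
  have : cube d k z = ⋂ i, {x | |x i - z i| < 3 ^ k / 2} := by
    ext x; simp [cube]
  rw [this]
  exact MeasurableSet.iInter fun i => measurableSet_lt (by fun_prop) measurable_const

section Cutoff

variable {n : ℤ} {φ w : (Fin d → ℝ) → ℝ} {F : (Fin d → ℝ) → (Fin d → ℝ)} {A M L : ℝ}

lemma setAverage_sum_sq_mul_grad_le (hφ : ContDiff ℝ (⊤ : ℕ∞) φ)
    (hA : ∀ x ∈ Qc d n, ∑ i, grad d φ x i ^ 2 ≤ A)
    (hM : ∀ x ∈ Qc d n, ‖iteratedFDeriv ℝ 2 φ x‖ ≤ M) (hw : Measurable w) (hL : ∀ x, |w x| ≤ L)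
    (hF : ∀ x ∈ Qc d n, ∀ i, F x i = w x * grad d φ x i) {Q : Set (Fin d → ℝ)}
    (hQm : MeasurableSet Q) (h0 : volume Q ≠ 0) (ht : volume Q ≠ ⊤) (hQ : Q ⊆ Qc d n)
    {z : Fin d → ℝ} (hz : z ∈ Q) {r : ℝ} (hr : ∀ x ∈ Q, dist x z ≤ r) :
    ⨍ x in Q, ∑ i, (F x i - ⨍ y in Q, F y i) ^ 2
      ≤ 2 * A * (⨍ x in Q, (w x - ⨍ y in Q, w y) ^ 2)
        + 2 * (d * (M * r) ^ 2) * ⨍ x in Q, w x ^ 2 := by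
  have hM0 : 0 ≤ M := (norm_nonneg _).trans (hM z (hQ hz))
  have e : ∀ i, ⨍ y in Q, F y i = ⨍ y in Q, w y * grad d φ y i := fun i =>
    setAverage_congr_fun hQm (Filter.Eventually.of_forall fun y hy => hF y (hQ hy) i)
  have e2 : ⨍ x in Q, ∑ i, (F x i - ⨍ y in Q, F y i) ^ 2
      = ⨍ x in Q, ∑ i, (w x * grad d φ x i - ⨍ y in Q, w y * grad d φ y i) ^ 2 :=
    setAverage_congr_fun hQm (Filter.Eventually.of_forall fun x hx => by
      simp only [e, hF x (hQ hx)])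
  rw [e2]
  have : IsFiniteMeasure (volume.restrict Q) := ⟨by
    rw [Measure.restrict_apply_univ]; exact ht.lt_top⟩
  have : NeZero (volume.restrict Q) := ⟨by rwa [Ne, Measure.restrict_eq_zero]⟩
  have hae : ∀ᵐ x ∂((volume.restrict Q) Set.univ)⁻¹ • volume.restrict Q, x ∈ Q :=
    Measure.ae_smul_measure (ae_restrict_mem hQm) _
  exact integral_sum_sq_mul_sub_le
    (μ := ((volume.restrict Q) Set.univ)⁻¹ • volume.restrict Q) (c := fun i => grad d φ z i)
    (A := A) (B := d * (M * r) ^ 2) (L := L)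
    hw.aestronglyMeasurable (Filter.Eventually.of_forall hL)
    (fun i => (measurable_grad hφ i).aestronglyMeasurable)
    (hae.mono fun x hx => hA x (hQ hx)) (by positivity)
    (hae.mono fun x hx => by
      refine (Finset.sum_le_card_nsmul _ _ ((M * r) ^ 2) fun i _ => ?_).trans (le_of_eq ?_)
      · rw [← sq_abs]
        exact pow_le_pow_left₀ (abs_nonneg _) ((abs_grad_sub_le hφ hM (hQ hx) (hQ hz) i).trans
          (mul_le_mul_of_nonneg_left (hr x hx) hM0)) 2
      · rw [Finset.card_univ, Fintype.card_fin, nsmul_eq_mul])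

lemma avgSet_setAverage_le (hφ : ContDiff ℝ (⊤ : ℕ∞) φ)
    (hA : ∀ x ∈ Qc d n, ∑ i, grad d φ x i ^ 2 ≤ A)
    (hM : ∀ x ∈ Qc d n, ‖iteratedFDeriv ℝ 2 φ x‖ ≤ M) (hw : Measurable w) (hL : ∀ x, |w x| ≤ L)
    (hF : ∀ x ∈ Qc d n, ∀ i, F x i = w x * grad d φ x i) (p : ℕ) :
    avgSet (subLatt d (n - p) n) (fun z => ⨍ x in cube d (n - p) z,
        ∑ i, (F x i - ⨍ y in cube d (n - p) z, F y i) ^ 2)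
      ≤ 2 * A * (((6 * rad p + 1 : ℝ) ^ d)⁻¹ * ∑ m ∈ boxIdx d (3 * rad p),
          ⨍ x in block (n - p - 1) m, (w x - ⨍ y in block (n - p - 1) m, w y) ^ 2)
        + 2 * (d * (M * 3 ^ (n - p)) ^ 2) * (3 ^ d * ⨍ x in cell n 0, w x ^ 2) := by
  have h3 : (0 : ℝ) < 3 ^ (n - p) := by positivity
  have h6 : (0 : ℝ) < 6 * rad p + 1 := lt_of_lt_of_le (by positivity) (pow_le_six_rad p)
  have cov := sum_setAverage_block_le n p (hw.pow_const 2) (B := L ^ 2) (fun x => by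
    rw [abs_pow]; exact pow_le_pow_left₀ (abs_nonneg _) (hL x) 2) fun x => sq_nonneg _
  rw [avgSet_subLatt]
  refine le_trans ?_ (add_le_add_right (mul_le_mul_of_nonneg_left cov (by positivity)) _)
  rw [mul_left_comm (2 * A), mul_left_comm (2 * (d * (M * 3 ^ (n - p)) ^ 2)), ← mul_add,
    Finset.mul_sum _ _ (2 * A), Finset.mul_sum _ _ (2 * (d * (M * 3 ^ (n - (p : ℤ))) ^ 2)),
    ← Finset.sum_add_distrib]
  refine mul_le_mul_of_nonneg_left (Finset.sum_le_sum fun m hm => ?_)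
    (inv_nonneg.2 (pow_nonneg h6.le d))
  have hae := cube_ae_eq_block (n - p) m
  have hmem : latPt (n - p - 1) m ∈ cube d (n - p) (latPt (n - p - 1) m) := fun i => by
    rw [sub_self, abs_zero]; positivity
  have := setAverage_sum_sq_mul_grad_le hφ hA hM hw hL hF
    (measurableSet_cube (n - p) (latPt (n - p - 1) m))
    (by rw [measure_congr hae]; exact volume_block_ne_zero _ _)
    (by rw [measure_congr hae]; exact (volume_block_lt_top _ _).ne)
    ((cube_subset_Qc_iff n p m).2 hm) hmem (r := 3 ^ (n - p)) (fun x hx => by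
      rw [dist_pi_le_iff h3.le]
      intro i
      rw [Real.dist_eq]
      exact (hx i).le.trans (by linarith))
  rwa [setAverage_congr (f := fun x => w x ^ 2) hae, setAverage_congr (f := w) hae,
    setAverage_congr (f := fun x => (w x - ⨍ y in block (n - p - 1) m, w y) ^ 2) hae] at this

lemma setAverage_Qc_sum_sq_le (hφ : ContDiff ℝ (⊤ : ℕ∞) φ)
    (hA : ∀ x ∈ Qc d n, ∑ i, grad d φ x i ^ 2 ≤ A) (hw : Measurable w) (hL : ∀ x, |w x| ≤ L)
    (hF : ∀ x ∈ Qc d n, ∀ i, F x i = w x * grad d φ x i) :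
    ⨍ x in Qc d n, ∑ i, F x i ^ 2 ≤ A * ⨍ x in cell n 0, w x ^ 2 := by
  have hb : Bornology.IsBounded (Qc d n) := by rw [Qc_eq_ball]; exact Metric.isBounded_ball
  have hQm := (isOpen_Qc d n).measurableSet
  have e : ∀ x ∈ Qc d n, ∑ i, F x i ^ 2 = w x ^ 2 * ∑ i, grad d φ x i ^ 2 := fun x hx => by
    rw [Finset.mul_sum]
    exact Finset.sum_congr rfl fun i _ => by rw [hF x hx i, mul_pow]
  rw [← setAverage_congr (Qc_ae_eq_cell n), setAverage_eq, setAverage_eq, smul_eq_mul, smul_eq_mul,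
    mul_left_comm A, ← integral_const_mul A, setIntegral_congr_fun hQm e]
  refine mul_le_mul_of_nonneg_left (setIntegral_mono_on ?_
    ((integrableOn_sq hw hL hb).const_mul A) hQm fun x hx => ?_) (by positivity)
  · refine Measure.integrableOn_of_bounded (M := L ^ 2 * A) hb.measure_lt_top.ne
      ((hw.pow_const 2).mul (Finset.measurable_fun_sum _ fun i _ =>
        (measurable_grad hφ i).pow_const 2)).aestronglyMeasurable ?_
    filter_upwards [ae_restrict_mem hQm] with x hx
    rw [norm_mul, Real.norm_of_nonneg (Finset.sum_nonneg fun i _ => sq_nonneg _),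
      norm_pow]
    exact mul_le_mul (pow_le_pow_left₀ (norm_nonneg _) (hL x) 2) (hA x hx)
      (Finset.sum_nonneg fun i _ => sq_nonneg _) (sq_nonneg _)
  · rw [mul_comm]
    exact mul_le_mul_of_nonneg_right (hA x hx) (sq_nonneg _)

end Cutoff

/-! ### The cutoff estimate -/

section Assembly

lemma rpow_neg_mul_sub (t : ℝ) (n : ℤ) (j : ℕ) :
    (3 : ℝ) ^ (-2 * t * ((n : ℝ) - j))
      = ((3 : ℝ) ^ (-(t * n))) ^ 2 * ((((3 : ℝ) ^ (-t)) ^ 2)⁻¹) ^ j := by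
  have h3 : (0 : ℝ) < 3 := by norm_num
  rw [← Real.rpow_natCast _ 2, ← Real.rpow_natCast _ 2, ← Real.rpow_natCast _ j,
    ← Real.rpow_mul h3.le, ← Real.rpow_mul h3.le, ← Real.rpow_neg h3.le, ← Real.rpow_mul h3.le,
    ← Real.rpow_add h3]
  congr 1
  push_cast
  ring

lemma rpow_one_sub_mul_sub (t : ℝ) (n : ℤ) (j : ℕ) :
    (3 : ℝ) ^ (2 * (1 - t) * ((n : ℝ) - j))
      = ((3 : ℝ) ^ (-(t * n)) * 3 ^ n) ^ 2 * ((9 * ((3 : ℝ) ^ (-t)) ^ 2)⁻¹) ^ j := by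
  have h3 : (0 : ℝ) < 3 := by norm_num
  have h9 : (9 : ℝ) ^ j = (3 ^ j) ^ 2 := by rw [← pow_mul, mul_comm, pow_mul]; norm_num
  have e : (3 : ℝ) ^ (2 * (1 - t) * ((n : ℝ) - j))
      = 3 ^ (-2 * t * ((n : ℝ) - j)) * (3 ^ ((n : ℝ) - j)) ^ 2 := by
    rw [← Real.rpow_natCast _ 2, ← Real.rpow_mul h3.le, ← Real.rpow_add h3]
    congr 1
    push_cast
    ring
  rw [e, rpow_neg_mul_sub, Real.rpow_sub h3, Real.rpow_intCast, Real.rpow_natCast, mul_inv,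
    mul_pow _ (((3 : ℝ) ^ (-t)) ^ 2)⁻¹ j, inv_pow 9, h9]
  ring

variable {n : ℤ} {u : (Fin d → ℝ) → ℝ} {L : ℝ}

lemma setAverage_block_indicator {f : (Fin d → ℝ) → ℝ} {p : ℕ} {m : Fin d → ℤ}
    (hm : m ∈ boxIdx d (3 * rad p)) :
    ⨍ x in block (n - p - 1) m, (closure (Qc d n)).indicator f x
      = ⨍ x in cube d (n - p) (latPt (n - p - 1) m), f x := by
  rw [setAverage_congr (cube_ae_eq_block (n - p) m)]
  refine setAverage_congr_fun (measurableSet_block _ _) (Filter.Eventually.of_forall fun x hx => ?_)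
  exact Set.indicator_of_mem (cell_zero_subset_closure_Qc n (block_subset_cell_zero hm hx)) f

lemma avgSet_sum_setAverage_sq (F : (Fin d → ℝ) → Fin d → ℝ) (p : ℕ) :
    avgSet (subLatt d (n - p) n) (fun z => ∑ i, (⨍ x in cube d (n - p) z, F x i) ^ 2)
      = ((6 * rad p + 1 : ℝ) ^ d)⁻¹ * ∑ m ∈ boxIdx d (3 * rad p), ∑ i,
        (⨍ x in block (n - p - 1) m, (closure (Qc d n)).indicator (fun x => F x i) x) ^ 2 := by
  rw [avgSet_subLatt]
  congr 1
  refine Finset.sum_congr rfl fun m hm => Finset.sum_congr rfl fun i _ => ?_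
  rw [setAverage_block_indicator hm]

lemma avgSet_nonneg {α : Type*} {S : Set α} {f : α → ℝ} (hf : ∀ z, 0 ≤ f z) : 0 ≤ avgSet S f :=
  mul_nonneg (by positivity) (finsum_nonneg fun z => finsum_nonneg fun _ => hf z)

lemma average_sum_sq_nonneg (v : Fin d → (Fin d → ℝ) → ℝ) (p : ℕ) :
    0 ≤ ((6 * rad p + 1 : ℝ) ^ d)⁻¹ * ∑ m ∈ boxIdx d (3 * rad p), ∑ i,
      (⨍ x in block (n - p - 1) m, v i x) ^ 2 := by
  have h6 : (0 : ℝ) ≤ 6 * rad p + 1 := le_trans (by positivity) (pow_le_six_rad p)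
  positivity

lemma average_sum_sq_le {v : Fin d → (Fin d → ℝ) → ℝ} (hL : ∀ l x, |v l x| ≤ L) (p : ℕ) :
    ((6 * rad p + 1 : ℝ) ^ d)⁻¹ * ∑ m ∈ boxIdx d (3 * rad p), ∑ i,
      (⨍ x in block (n - p - 1) m, v i x) ^ 2 ≤ d * L ^ 2 := by
  have h6 : (0 : ℝ) < 6 * rad p + 1 := lt_of_lt_of_le (by positivity) (pow_le_six_rad p)
  have hr := rad_nonneg p
  have hc : ((boxIdx d (3 * rad p)).card : ℝ) = (6 * rad p + 1) ^ d := by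
    rw [card_boxIdx (by omega)]; push_cast; ring
  rw [inv_mul_le_iff₀ (by positivity), ← hc, ← nsmul_eq_mul]
  refine Finset.sum_le_card_nsmul _ _ _ fun m _ => ?_
  refine (Finset.sum_le_card_nsmul _ _ (L ^ 2) fun i _ => ?_).trans (le_of_eq ?_)
  · rw [← sq_abs]
    exact pow_le_pow_left₀ (abs_nonneg _) (abs_setAverage_le (volume_block_ne_zero _ _)
      (volume_block_lt_top _ _).ne fun x _ => hL i x) 2
  · rw [Finset.card_univ, Fintype.card_fin, nsmul_eq_mul]

lemma scaleSum_le_ringNeg {t : ℝ} (ha : 1 / 3 < (3 : ℝ) ^ (-t)) (F : (Fin d → ℝ) → Fin d → ℝ)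
    (hL : ∀ i x, |(closure (Qc d n)).indicator (fun x => F x i) x| ≤ L) :
    ((3 : ℝ) ^ (-(t * n))) ^ 2
        * scaleSum n (fun i => (closure (Qc d n)).indicator fun x => F x i) (3 ^ (-t))
      ≤ 3 ^ d * ((3 : ℝ) ^ (-n)) ^ 2 * ringNeg d (1 - t) n F ^ 2 := by
  set s : ℝ := (3 : ℝ) ^ (-(t * n))
  set a : ℝ := (3 : ℝ) ^ (-t)
  set v : Fin d → (Fin d → ℝ) → ℝ := fun i => (closure (Qc d n)).indicator fun x => F x i
  set b : ℕ → ℝ := fun p => ((6 * rad p + 1 : ℝ) ^ d)⁻¹ * ∑ m ∈ boxIdx d (3 * rad p), ∑ i,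
      (⨍ x in block (n - p - 1) m, v i x) ^ 2
  have hb0 : ∀ p, 0 ≤ b p := fun p => average_sum_sq_nonneg v p
  have hsum : Summable fun p => ((9 * a ^ 2)⁻¹) ^ p * b p :=
    summable_geometric_mul (by positivity) (inv_sq_lt_one ha) hb0 (average_sum_sq_le hL)
  have hX : ringNeg d (1 - t) n F ^ 2 = (s * 3 ^ n) ^ 2 * ∑' p, ((9 * a ^ 2)⁻¹) ^ p * b p := by
    rw [ringNeg, ← tsum_mul_left, Real.sq_sqrt]
    · refine tsum_congr fun p => ?_
      rw [rpow_one_sub_mul_sub, avgSet_sum_setAverage_sq, mul_assoc]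
    · refine tsum_nonneg fun p => mul_nonneg (by positivity) ?_
      rw [avgSet_sum_setAverage_sq]
      exact hb0 p
  have hY : scaleSum n v a ≤ 3 ^ d * ∑' p, ((9 * a ^ 2)⁻¹) ^ p * b p := by
    rw [← tsum_mul_left]
    refine Summable.tsum_le_tsum (fun p => ?_) (summable_scaleSum n ha hL) (hsum.mul_left _)
    rw [mul_left_comm]
    exact mul_le_mul_of_nonneg_left (setAverage_sum_cellAvg_sq_le n p hL) (by positivity)
  have h3 : ((3 : ℝ) ^ (-n)) ^ 2 * (3 ^ n) ^ 2 = 1 := by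
    rw [← mul_pow, zpow_neg, inv_mul_cancel₀ (by positivity), one_pow]
  calc s ^ 2 * scaleSum n v a
      ≤ s ^ 2 * (3 ^ d * ∑' p, ((9 * a ^ 2)⁻¹) ^ p * b p) :=
        mul_le_mul_of_nonneg_left hY (sq_nonneg s)
    _ = 3 ^ d * ((3 : ℝ) ^ (-n)) ^ 2 * ((s * 3 ^ n) ^ 2 * ∑' p, ((9 * a ^ 2)⁻¹) ^ p * b p) := by
        linear_combination -(s ^ 2 * 3 ^ d * ∑' p, ((9 * a ^ 2)⁻¹) ^ p * b p) * h3
    _ = _ := by rw [hX]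

lemma mul_sqrt_le_of_sq_mul_le {s κ Y D r X Z : ℝ} (hs : 0 ≤ s) (hκ : 0 ≤ κ) (hD : 0 ≤ D)
    (hr : 0 ≤ r) (hX : 0 ≤ X) (h : s ^ 2 * Y ≤ D * r ^ 2 * X ^ 2) (hZ : Z ≤ κ * Y) :
    s * √Z ≤ √(κ * D) * r * X := by
  have e1 : s * √Z = √(s ^ 2 * Z) := by
    rw [Real.sqrt_mul (sq_nonneg s), Real.sqrt_sq hs]
  have e2 : √(κ * D) * r * X = √(κ * D * (r * X) ^ 2) := by
    rw [Real.sqrt_mul (mul_nonneg hκ hD), Real.sqrt_sq (mul_nonneg hr hX), mul_assoc]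
  rw [e1, e2]
  refine Real.sqrt_le_sqrt ?_
  nlinarith [mul_le_mul_of_nonneg_left hZ (sq_nonneg s), mul_le_mul_of_nonneg_left h hκ]

/-- The constant bounding the squared `L²` norm of `u ∇φ`. -/
def lebesgueConst (d : ℕ) (a C₀ : ℝ) : ℝ := C₀ ^ 2 * poincareConst d (9 * a)⁻¹

/-- The constant bounding the squared fractional seminorm of `u ∇φ`. -/
def seminormConst (d : ℕ) (a C₀ : ℝ) : ℝ :=
  2 * C₀ ^ 2 * poincareConst d (9 * a)⁻¹ * 3 ^ d * ((1 - a)⁻¹ + d * (1 - (9 * a ^ 2)⁻¹)⁻¹)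

lemma sum_avgSet_setAverage_le {φ w : (Fin d → ℝ) → ℝ} {F : (Fin d → ℝ) → Fin d → ℝ}
    {v : Fin d → (Fin d → ℝ) → ℝ} {a C₀ : ℝ} (ha : 1 / 3 < a) (ha1 : a < 1)
    (hφ : ContDiff ℝ (⊤ : ℕ∞) φ)
    (hA : ∀ x ∈ Qc d n, ∑ i, grad d φ x i ^ 2 ≤ C₀ ^ 2 * (9 ^ n)⁻¹)
    (hM : ∀ x ∈ Qc d n, ‖iteratedFDeriv ℝ 2 φ x‖ ≤ C₀ * 3 ^ (-(2 * n)))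
    (hw : IsPotentialOn (cell n 0) v w L) (h0 : ⨍ x in cell n 0, w x = 0)
    (hF : ∀ x ∈ Qc d n, ∀ i, F x i = w x * grad d φ x i) (P : ℕ) :
    ∑ p ∈ Finset.range P, ((a ^ 2)⁻¹) ^ p *
        avgSet (subLatt d (n - p) n) (fun z => ⨍ x in cube d (n - p) z,
          ∑ i, (F x i - ⨍ y in cube d (n - p) z, F y i) ^ 2)
      ≤ seminormConst d a C₀ * scaleSum n v a := by
  set K := poincareConst d (9 * a)⁻¹ with hK
  set Y := scaleSum n v a with hY
  set S : ℕ → ℝ := fun p => ((6 * rad p + 1 : ℝ) ^ d)⁻¹ * ∑ m ∈ boxIdx d (3 * rad p),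
    ⨍ x in block (n - p - 1) m, (w x - ⨍ y in block (n - p - 1) m, w y) ^ 2
  set W : ℝ := ⨍ x in cell n 0, w x ^ 2
  have hK0 : 0 ≤ K := poincareConst_nonneg (one_ninth_lt_inv ha ha1)
  have hY0 : 0 ≤ Y := scaleSum_nonneg n v a
  have hq1 := inv_sq_lt_one ha
  have hq0 : 0 ≤ (9 * a ^ 2)⁻¹ := by positivity
  have h9n : (9 : ℝ) ^ n ≠ 0 := by positivity
  have hnine : (9 : ℝ) ^ n = 3 ^ n * 3 ^ n := by rw [← mul_zpow]; norm_num
  have hterm : ∀ p : ℕ, ((a ^ 2)⁻¹) ^ p * avgSet (subLatt d (n - p) n) (fun z =>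
      ⨍ x in cube d (n - p) z, ∑ i, (F x i - ⨍ y in cube d (n - p) z, F y i) ^ 2)
      ≤ 2 * (C₀ ^ 2 * (9 ^ n)⁻¹) * (((a ^ 2)⁻¹) ^ p * S p)
        + 2 * (d * (C₀ ^ 2 * (9 ^ n)⁻¹)) * 3 ^ d * W * ((9 * a ^ 2)⁻¹) ^ p := fun p => by
    have h := mul_le_mul_of_nonneg_left (avgSet_setAverage_le hφ hA hM hw.measurable_u hw.abs_u_le
      hF p) (show 0 ≤ ((a ^ 2)⁻¹) ^ p by positivity)
    have e : (C₀ * 3 ^ (-(2 * n)) * (3 : ℝ) ^ (n - p)) ^ 2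
        = C₀ ^ 2 * (9 ^ n)⁻¹ * ((9 : ℝ)⁻¹) ^ p := by
      have h9p : ((9 : ℝ)⁻¹) ^ p = (3 ^ p)⁻¹ * (3 ^ p)⁻¹ := by
        rw [← mul_inv, ← mul_pow, inv_pow]; norm_num
      rw [h9p, hnine, zpow_neg, zpow_sub₀ (by norm_num), zpow_natCast, two_mul,
        zpow_add₀ (by norm_num)]
      field_simp
    refine h.trans (le_of_eq ?_)
    rw [e, mul_inv, mul_pow]
    ring
  have hgeom : ∑ p ∈ Finset.range P, ((9 * a ^ 2)⁻¹) ^ p ≤ (1 - (9 * a ^ 2)⁻¹)⁻¹ := by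
    rw [← tsum_geometric_of_lt_one hq0 hq1]
    exact (summable_geometric_of_lt_one hq0 hq1).sum_le_tsum _ fun p _ => pow_nonneg hq0 p
  have hW : W ≤ K * 9 ^ n * Y := setAverage_cell_sq_le ha ha1 hw h0
  have hS : ∑ p ∈ Finset.range P, ((a ^ 2)⁻¹) ^ p * S p ≤ K * 3 ^ d * 9 ^ n * ((1 - a)⁻¹ * Y) :=
    sum_setAverage_sq_sub_le ha ha1 hw P
  have hG0 : 0 ≤ (1 - (9 * a ^ 2)⁻¹)⁻¹ := inv_nonneg.2 (by linarith)
  refine (Finset.sum_le_sum fun p _ => hterm p).trans ?_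
  rw [Finset.sum_add_distrib, ← Finset.mul_sum, ← Finset.mul_sum]
  calc _ ≤ 2 * (C₀ ^ 2 * (9 ^ n)⁻¹) * (K * 3 ^ d * 9 ^ n * ((1 - a)⁻¹ * Y))
        + 2 * (d * (C₀ ^ 2 * (9 ^ n)⁻¹)) * 3 ^ d * (K * 9 ^ n * Y) * (1 - (9 * a ^ 2)⁻¹)⁻¹ := by
        gcongr
    _ = seminormConst d a C₀ * Y := by
        rw [seminormConst, ← hK]
        linear_combination (2 * C₀ ^ 2 * K * 3 ^ d * Y *
          ((1 - a)⁻¹ + d * (1 - (9 * a ^ 2)⁻¹)⁻¹)) * inv_mul_cancel₀ h9n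

end Assembly

end TriadicGrid

/-- Cutoff multiplication estimate. -/
theorem stmt4 (d : ℕ) (hd : 1 ≤ d) (t : ℝ) (ht : t ∈ Set.Ioo (0 : ℝ) 1)
    (C₀ : ℝ) (hC₀ : 0 < C₀) :
    ∃ C : ℝ, 0 < C ∧ ∀ (n : ℤ) (φ u : (Fin d → ℝ) → ℝ),
      ContDiff ℝ (⊤ : ℕ∞) φ →
      (∀ x ∈ Qc d (n - 1), φ x = 1) →
      (∀ x ∈ Qc d n, Real.sqrt (∑ i, (grad d φ x i) ^ 2) ≤ C₀ * (3 : ℝ) ^ (-n)) →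
      (∀ x ∈ Qc d n, ‖iteratedFDeriv ℝ 2 φ x‖ ≤ C₀ * (3 : ℝ) ^ (-(2 * n))) →
      (∃ V, IsOpen V ∧ closure (Qc d n) ⊆ V ∧ ContDiffOn ℝ 1 u V) →
      (⨍ x in Qc d n, u x) = 0 →
      vecFracNorm d t n (fun x => u x • grad d φ x) ≤
        C * (3 : ℝ) ^ (-n) * ringNeg d (1 - t) n (grad d u) := by
  set a : ℝ := (3 : ℝ) ^ (-t) with ha_def
  have ha : 1 / 3 < a := by
    rw [one_div, ← Real.rpow_neg_one]
    exact Real.rpow_lt_rpow_of_exponent_lt (by norm_num) (by linarith [ht.2])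
  have ha1 : a < 1 := Real.rpow_lt_one_of_one_lt_of_neg (by norm_num) (by linarith [ht.1])
  have hκ : 0 ≤ TriadicGrid.poincareConst d (9 * a)⁻¹ :=
    TriadicGrid.poincareConst_nonneg (TriadicGrid.one_ninth_lt_inv ha ha1)
  have hκ₁ : 0 ≤ TriadicGrid.lebesgueConst d a C₀ := mul_nonneg (sq_nonneg _) hκ
  have hκ₂ : 0 ≤ TriadicGrid.seminormConst d a C₀ := by
    have h1 : 0 ≤ (1 - a)⁻¹ := inv_nonneg.2 (by linarith)
    have h2 : 0 ≤ (1 - (9 * a ^ 2)⁻¹)⁻¹ :=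
      inv_nonneg.2 (by linarith [TriadicGrid.inv_sq_lt_one ha])
    rw [TriadicGrid.seminormConst]
    positivity
  refine ⟨√(TriadicGrid.lebesgueConst d a C₀ * 3 ^ d)
    + √(TriadicGrid.seminormConst d a C₀ * 3 ^ d) + 1, by positivity, ?_⟩
  rintro n φ u hφ - hgrad hhess ⟨V, hV, hQV, hu⟩ hmean
  obtain ⟨L, hw⟩ := TriadicGrid.exists_isPotentialOn hV hQV hu
  set w := (closure (Qc d n)).indicator u
  have hwu : ∀ x ∈ Qc d n, w x = u x := fun x hx => Set.indicator_of_mem (subset_closure hx) u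
  have h0 : ⨍ x in TriadicGrid.cell n 0, w x = 0 := by
    rw [← setAverage_congr (TriadicGrid.Qc_ae_eq_cell n), ← hmean]
    exact setAverage_congr_fun (TriadicGrid.isOpen_Qc d n).measurableSet
      (Filter.Eventually.of_forall hwu)
  have hF : ∀ x ∈ Qc d n, ∀ i, (u x • grad d φ x) i = w x * grad d φ x i := fun x hx i => by
    rw [hwu x hx, Pi.smul_apply, smul_eq_mul]
  have hA : ∀ x ∈ Qc d n, ∑ i, grad d φ x i ^ 2 ≤ C₀ ^ 2 * (9 ^ n)⁻¹ := fun x hx => by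
    have h9 : (9 : ℝ) ^ n = (3 ^ n) ^ 2 := by rw [sq, ← mul_zpow]; norm_num
    rw [h9, ← inv_pow, ← zpow_neg, ← mul_pow]
    exact (Real.sqrt_le_left (by positivity)).1 (hgrad x hx)
  have hXY := TriadicGrid.scaleSum_le_ringNeg ha (grad d u) hw.abs_v_le
  have hX : 0 ≤ ringNeg d (1 - t) n (grad d u) := Real.sqrt_nonneg _
  have hs : 0 ≤ (3 : ℝ) ^ (-(t * n)) := by positivity
  have hL2 : ⨍ x in Qc d n, ∑ i, (u x • grad d φ x) i ^ 2 ≤ TriadicGrid.lebesgueConst d a C₀ *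
      TriadicGrid.scaleSum n (fun i => (closure (Qc d n)).indicator fun x => grad d u x i) a := by
    refine (TriadicGrid.setAverage_Qc_sum_sq_le hφ hA hw.measurable_u hw.abs_u_le hF).trans ?_
    refine (mul_le_mul_of_nonneg_left (TriadicGrid.setAverage_cell_sq_le ha ha1 hw h0)
      (by positivity)).trans (le_of_eq ?_)
    rw [TriadicGrid.lebesgueConst]
    field_simp
  have hsemi := Real.tsum_le_of_sum_range_le (fun p => mul_nonneg (by positivity)
    (TriadicGrid.avgSet_nonneg fun z => TriadicGrid.setAverage_nonneg
      (fun x => Finset.sum_nonneg fun i _ => sq_nonneg _) _))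
    (TriadicGrid.sum_avgSet_setAverage_le ha ha1 hφ hA hhess hw h0 hF)
  have h1 := TriadicGrid.mul_sqrt_le_of_sq_mul_le hs hκ₁ (by positivity) (by positivity) hX hXY hL2
  have h2 := TriadicGrid.mul_sqrt_le_of_sq_mul_le hs hκ₂ (by positivity) (by positivity) hX hXY
    hsemi
  have h3 : 0 ≤ (3 : ℝ) ^ (-n) * ringNeg d (1 - t) n (grad d u) := mul_nonneg (by positivity) hX
  rw [vecFracNorm, vecL2]
  simp only [TriadicGrid.rpow_neg_mul_sub, mul_assoc (((3 : ℝ) ^ (-(t * n))) ^ 2)]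
  rw [tsum_mul_left, Real.sqrt_mul (sq_nonneg _), Real.sqrt_sq hs]
  linarith

end
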